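/- arXiv:1804.07054 — 2 statements merged into one kernel-verified Lean document; each statement's English description precedes it below -/
import Mathlib

section
/- Let n ≥ 1 and let q = e^{2πi/3} ∈ ℂ. Then the number of n×n alternating sign matrices equals the complex determinant det_{0≤i,j≤n−1}( C(i+j, j) · (1 − (−q)^{j+1−i})/(1+q) ), where C(i+j,j) denotes the binomial coefficient (i+j choose j) and (−q)^{j+1−i} is computed in ℂ (with negative integer exponents allowed since −q is a unit). -/
open scoped BigOperators

/-- An `n×n` alternating sign matrix: entries in `{−1,0,1}`, all row and column sums equal `1`,
and all partial (prefix) sums of rows and columns lie in `{0,1}` (which is equivalent to the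
non-zero entries alternating in sign in every row and column). -/
def IsASM (n : ℕ) (A : Matrix (Fin n) (Fin n) ℤ) : Prop :=
  (∀ i j, A i j = -1 ∨ A i j = 0 ∨ A i j = 1) ∧
  (∀ i, ∑ j, A i j = 1) ∧
  (∀ j, ∑ i, A i j = 1) ∧
  (∀ i k, 0 ≤ ∑ j ∈ Finset.univ.filter (fun j : Fin n => j ≤ k), A i j ∧
      ∑ j ∈ Finset.univ.filter (fun j : Fin n => j ≤ k), A i j ≤ 1) ∧
  (∀ j k, 0 ≤ ∑ i ∈ Finset.univ.filter (fun i : Fin n => i ≤ k), A i j ∧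
      ∑ i ∈ Finset.univ.filter (fun i : Fin n => i ≤ k), A i j ≤ 1)

namespace ASM

section SignSum

open Equiv

/-- The permutation with `0 ↦ p` and `j.succ ↦ p.succAbove (e j)`. -/
def consPerm {n : ℕ} (p : Fin (n + 1)) (e : Perm (Fin n)) : Perm (Fin (n + 1)) :=
  p.cycleRange.symm * Perm.decomposeFin.symm (0, e)

lemma consPerm_zero {n : ℕ} (p : Fin (n + 1)) (e : Perm (Fin n)) : consPerm p e 0 = p := by
  simp [consPerm]

lemma consPerm_succ {n : ℕ} (p : Fin (n + 1)) (e : Perm (Fin n)) (j : Fin n) :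
    consPerm p e j.succ = p.succAbove (e j) := by
  simp [consPerm]

lemma sign_consPerm {n : ℕ} (p : Fin (n + 1)) (e : Perm (Fin n)) :
    Perm.sign (consPerm p e) = (-1) ^ (p : ℕ) * Perm.sign e := by
  simp [consPerm]

lemma consPerm_bijective {n : ℕ} :
    Function.Bijective fun x : Fin (n + 1) × Perm (Fin n) => consPerm x.1 x.2 := by
  rw [Fintype.bijective_iff_injective_and_card]
  refine ⟨?_, by simp [Fintype.card_perm, Nat.factorial_succ]⟩
  rintro ⟨p, e⟩ ⟨p', e'⟩ h
  have h0 : p = p' := by simpa [consPerm_zero] using congrArg (fun σ => σ 0) h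
  subst h0
  simp only [consPerm, mul_right_inj, EmbeddingLike.apply_eq_iff_eq, Prod.mk.injEq, true_and] at h
  rw [h]

lemma sum_sign_perm_succ {n : ℕ} {R : Type*} [CommRing R] (Φ : Perm (Fin (n + 1)) → R) :
    ∑ σ, ((Perm.sign σ : ℤ) : R) * Φ σ =
      ∑ p : Fin (n + 1), (-1) ^ (p : ℕ) *
        ∑ e : Perm (Fin n), ((Perm.sign e : ℤ) : R) * Φ (consPerm p e) := by
  rw [← consPerm_bijective.sum_comp, Fintype.sum_prod_type]
  simp [sign_consPerm, Finset.mul_sum, mul_assoc]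

/-- Up to the sign `(-1) ^ j`, this is `(1 + x) ^ (n - 1) * h_j (x, - (1 + x)⁻¹)`, where `h_j` is
the complete homogeneous symmetric polynomial. -/
def twoVarPoly {R : Type*} [CommRing R] (n j : ℕ) (x : R) : R :=
  (-1) ^ j * ∑ b ∈ Finset.range (j + 1), (1 + x) ^ (n - 1 - j + b) * (-x) ^ b

lemma prod_one_add_mul_eq {R : Type*} [CommRing R] {n : ℕ} (x : R) (P Q : Polynomial R)
    (hP : P.natDegree ≤ n) (hQ : Q = (1 + Polynomial.X * Polynomial.C x) * P) :
    P.eval (1 + x) = ∑ j : Fin (n + 1), ((-1) ^ (j : ℕ) * Q.coeff (n - j)) *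
      twoVarPoly (n + 1) j x := by
  have key : ∀ l, l ≤ n + 1 → ∑ i ∈ Finset.range l, P.coeff i * (1 + x) ^ i
      - x * ((if l = 0 then 0 else P.coeff (l - 1)) *
        ∑ b ∈ Finset.range (n + 1 - l), (1 + x) ^ (l + b) * (-x) ^ b) =
      ∑ i ∈ Finset.range l, Q.coeff i *
        ∑ b ∈ Finset.range (n + 1 - i), (1 + x) ^ (i + b) * (-x) ^ b := by
    intro l
    induction l with
    | zero => simp
    | succ l ih =>
      intro hl
      rw [Finset.sum_range_succ, Finset.sum_range_succ _ l, ← ih (by omega)]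
      have h1 : n + 1 - l = n + 1 - (l + 1) + 1 := by omega
      have h2 : ∑ b ∈ Finset.range (n + 1 - l), (1 + x) ^ (l + b) * (-x) ^ b =
          (1 + x) ^ l - x * ∑ b ∈ Finset.range (n + 1 - (l + 1)),
            (1 + x) ^ (l + 1 + b) * (-x) ^ b := by
        rw [h1, Finset.sum_range_succ', Finset.mul_sum, sub_eq_add_neg, ← Finset.sum_neg_distrib,
          add_comm]
        congr 1
        · simp
        · refine Finset.sum_congr rfl fun b _ => ?_
          rw [show l + (b + 1) = l + 1 + b by ring]; ring
      have h3 : Q.coeff l = P.coeff l + x * (if l = 0 then 0 else P.coeff (l - 1)) := by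
        rw [hQ, add_mul, one_mul, Polynomial.coeff_add, mul_right_comm, Polynomial.coeff_mul_C]
        cases l <;> simp [mul_comm]
      rw [h3, if_neg (Nat.succ_ne_zero l), Nat.succ_sub_one, h2]
      ring
  have h := key (n + 1) le_rfl
  rw [Nat.sub_self, Finset.sum_range_zero, mul_zero, mul_zero, sub_zero] at h
  rw [Polynomial.eval_eq_sum_range' (Nat.lt_succ_of_le hP), h, ← Finset.sum_range_reflect,
    Finset.sum_range]
  refine Finset.sum_congr rfl fun j _ => ?_
  have hj := j.2
  rw [twoVarPoly, show n + 1 - 1 - (j : ℕ) = n - j by omega,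
    show n + 1 - (n - (j : ℕ)) = j + 1 by omega,
    mul_mul_mul_comm, mul_comm (Q.coeff _), mul_assoc, ← mul_assoc ((-1) ^ (j : ℕ)), ← pow_add,
    ← two_mul, pow_mul]
  simp [mul_comm]

/-- The product of `1 + x_j + x_i x_j` over all pairs `i < j`. -/
def ascProd {R : Type*} [CommRing R] {n : ℕ} (x : Fin n → R) : R :=
  ∏ i, ∏ j, if i < j then 1 + x j + x i * x j else 1

lemma ascProd_succ {R : Type*} [CommRing R] {n : ℕ} (x : Fin (n + 1) → R) :
    ascProd x = (∏ j : Fin n, (1 + (1 + x 0) * x j.succ)) * ascProd fun i => x i.succ := by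
  simp only [ascProd, Fin.prod_univ_succ, Fin.succ_pos, if_true, Fin.succ_lt_succ_iff, if_false,
    Fin.not_lt_zero, one_mul]
  congr 1
  exact Finset.prod_congr rfl fun j _ => by ring

lemma one_add_mul_twoVarPoly {R : Type*} [CommRing R] {n j : ℕ} (hj : j < n) (x : R) :
    (1 + x) * twoVarPoly n j x = twoVarPoly (n + 1) j x := by
  simp only [twoVarPoly, Finset.mul_sum]
  refine Finset.sum_congr rfl fun b _ => ?_
  rw [show n + 1 - 1 - j + b = n - 1 - j + b + 1 by omega]
  ring

theorem sum_sign_ascProd_eq_det {R : Type*} [CommRing R] (n : ℕ) (x : Fin n → R) :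
    ∑ σ : Perm (Fin n), ((Perm.sign σ : ℤ) : R) *
      (ascProd (x ∘ σ) * ∏ i, (1 + x (σ i)) ^ (i : ℕ)) =
      (Matrix.of fun i j : Fin n => twoVarPoly n j (x i)).det := by
  induction n with
  | zero => simp [ascProd]
  | succ n ih =>
    set M : Matrix (Fin (n + 1)) (Fin (n + 1)) R :=
      Matrix.of fun i j : Fin (n + 1) => twoVarPoly (n + 1) j (x i) with hM
    set Q : Polynomial R := ∏ i, (1 + Polynomial.X * Polynomial.C (x i)) with hQ
    have hcol (p : Fin (n + 1)) : ∏ j : Fin n, (1 + (1 + x p) * x (p.succAbove j)) =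
        ∑ j : Fin (n + 1), ((-1) ^ (j : ℕ) * Q.coeff (n - j)) • M p j := by
      have h := prod_one_add_mul_eq (n := n) (x p)
        (∏ j : Fin n, (1 + Polynomial.X * Polynomial.C (x (p.succAbove j)))) Q ?_ ?_
      · simpa [Polynomial.eval_prod, hM, mul_comm (x _)] using h
      · refine (Polynomial.natDegree_prod_le _ _).trans ?_
        refine (Finset.sum_le_card_nsmul _ _ 1 fun j _ => ?_).trans (by simp)
        compute_degree
      · rw [hQ, Fin.prod_univ_succAbove _ p]
    have hQ0 : Q.coeff 0 = 1 := by
      simp [hQ, Polynomial.coeff_zero_eq_eval_zero, Polynomial.eval_prod]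
    have hdet := M.det_updateCol_sum (Fin.last n) fun j => (-1) ^ (j : ℕ) * Q.coeff (n - j)
    rw [Matrix.det_succ_column _ (Fin.last n)] at hdet
    simp only [Fin.val_last, Nat.sub_self, hQ0, mul_one, smul_eq_mul] at hdet
    have hsq : ((-1 : R) ^ n) * (-1) ^ n = 1 := by rw [← mul_pow]; simp
    rw [show M.det = (-1) ^ n * ((-1) ^ n * M.det) by rw [← mul_assoc, hsq, one_mul], ← hdet,
      sum_sign_perm_succ, Finset.mul_sum]
    refine Finset.sum_congr rfl fun p _ => ?_
    have hminor : ((M.updateCol (Fin.last n) fun k => ∑ j : Fin (n + 1),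
          ((-1) ^ (j : ℕ) * Q.coeff (n - j)) * M k j).submatrix p.succAbove
            (Fin.last n).succAbove).det =
        (∏ j : Fin n, (1 + x (p.succAbove j))) * (Matrix.of fun i j : Fin n =>
          twoVarPoly n j (x (p.succAbove i))).det := by
      rw [← Matrix.det_mul_column]
      congr 1
      ext i j
      simp [hM, one_add_mul_twoVarPoly, Fin.succAbove_last]
    rw [hminor, ← ih, Matrix.updateCol_self]
    have h := hcol p
    simp only [smul_eq_mul] at h
    rw [← h, Finset.mul_sum, Finset.mul_sum, Finset.mul_sum, Finset.mul_sum]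
    refine Finset.sum_congr rfl fun e _ => ?_
    rw [ascProd_succ, Fin.prod_univ_succ]
    simp only [Function.comp_def, consPerm_zero, consPerm_succ, Fin.val_zero, pow_zero, one_mul,
      Fin.val_succ, pow_succ, Finset.prod_mul_distrib]
    rw [Equiv.prod_comp e fun j => 1 + (1 + x p) * x (p.succAbove j),
      Equiv.prod_comp e fun j => 1 + x (p.succAbove j), pow_add]
    linear_combination (-1 : R) * ((-1) ^ (p : ℕ) * ((Perm.sign e : ℤ) : R) *
      (∏ j : Fin n, (1 + (1 + x p) * x (p.succAbove j))) *
      ascProd (fun i => x (p.succAbove (e i))) * (∏ j : Fin n, (1 + x (p.succAbove j))) *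
      ∏ i, (1 + x (p.succAbove (e i))) ^ (i : ℕ)) * hsq

end SignSum

section AltCoeff

open Equiv

/-- The alternating sum of the coefficients of the monomials `∏ i, X i ^ (σ i + s)`. -/
noncomputable def altCoeff (s m : ℕ) : MvPolynomial (Fin m) ℤ →ₗ[ℤ] ℤ :=
  ∑ σ : Perm (Fin m), (Perm.sign σ : ℤ) •
    MvPolynomial.lcoeff ℤ (Finsupp.equivFunOnFinite.symm fun i => (σ i : ℕ) + s)

lemma altCoeff_apply (s m : ℕ) (g : MvPolynomial (Fin m) ℤ) :
    altCoeff s m g = ∑ σ : Perm (Fin m), (Perm.sign σ : ℤ) *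
      g.coeff (Finsupp.equivFunOnFinite.symm fun i => (σ i : ℕ) + s) := by
  simp [altCoeff]

lemma mapDomain_equivFunOnFinite_symm {m : ℕ} (τ : Perm (Fin m)) (d : Fin m → ℕ) :
    (Finsupp.equivFunOnFinite.symm (d ∘ τ)).mapDomain τ = Finsupp.equivFunOnFinite.symm d := by
  ext i
  obtain ⟨j, rfl⟩ := τ.surjective i
  rw [Finsupp.mapDomain_apply τ.injective]
  rfl

lemma coeff_rename_perm {m : ℕ} (τ : Perm (Fin m)) (d : Fin m → ℕ) (g : MvPolynomial (Fin m) ℤ) :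
    (MvPolynomial.rename τ g).coeff (Finsupp.equivFunOnFinite.symm d) =
      g.coeff (Finsupp.equivFunOnFinite.symm (d ∘ τ)) := by
  rw [← mapDomain_equivFunOnFinite_symm τ, MvPolynomial.coeff_rename_mapDomain _ τ.injective]

lemma altCoeff_rename (s m : ℕ) (τ : Perm (Fin m)) (g : MvPolynomial (Fin m) ℤ) :
    altCoeff s m (MvPolynomial.rename τ g) = (Perm.sign τ : ℤ) * altCoeff s m g := by
  simp only [altCoeff_apply, coeff_rename_perm]
  rw [Finset.mul_sum, ← Equiv.sum_comp (Equiv.mulRight τ)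
    fun σ : Perm (Fin m) => (Perm.sign τ : ℤ) * ((Perm.sign σ : ℤ) *
      g.coeff (Finsupp.equivFunOnFinite.symm fun i => (σ i : ℕ) + s))]
  refine Finset.sum_congr rfl fun σ _ => ?_
  rw [← mul_assoc, Equiv.coe_mulRight, Perm.sign_mul, Units.val_mul, mul_left_comm,
    ← Units.val_mul, Int.units_mul_self]
  simp [Function.comp_def]

lemma altCoeff_eq_zero_of_rename_swap {s m : ℕ} {i j : Fin m} (hij : i ≠ j)
    {g : MvPolynomial (Fin m) ℤ} (h : MvPolynomial.rename (swap i j) g = g) :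
    altCoeff s m g = 0 := by
  have := altCoeff_rename s m (swap i j) g
  rw [h, Perm.sign_swap hij] at this
  simp at this
  lia

lemma altCoeff_prod_X_mul (s m : ℕ) (g : MvPolynomial (Fin m) ℤ) :
    altCoeff (s + 1) m ((∏ i, MvPolynomial.X i) * g) = altCoeff s m g := by
  simp only [altCoeff_apply]
  refine Finset.sum_congr rfl fun σ _ => ?_
  have h1 : (∏ i, MvPolynomial.X i : MvPolynomial (Fin m) ℤ) =
      MvPolynomial.monomial (Finsupp.equivFunOnFinite.symm fun _ => 1) 1 := by
    rw [MvPolynomial.monomial_eq, Finsupp.prod_fintype _ _ (by simp)]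
    simp
  have h2 : (Finsupp.equivFunOnFinite.symm fun i => (σ i : ℕ) + (s + 1) : Fin m →₀ ℕ) =
      (Finsupp.equivFunOnFinite.symm fun _ => 1) +
        Finsupp.equivFunOnFinite.symm fun i => (σ i : ℕ) + s := by
    ext i; simp; ring
  rw [h1, h2, MvPolynomial.coeff_monomial_mul, one_mul]

lemma altCoeff_succ (m : ℕ) (g : MvPolynomial (Fin (m + 1)) ℤ) :
    altCoeff 0 (m + 1) g = ∑ p : Fin (m + 1), (-1) ^ (p : ℕ) *
      altCoeff 1 m (MvPolynomial.killCompl p.succAbove_right_injective g) := by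
  rw [altCoeff_apply, ← Equiv.sum_comp (Equiv.inv _)]
  simp only [Equiv.inv_apply, Perm.sign_inv]
  have h := sum_sign_perm_succ (R := ℤ) (n := m) fun σ => g.coeff
    (Finsupp.equivFunOnFinite.symm fun i => (σ⁻¹ i : ℕ) + 0)
  simp only [Int.cast_id] at h
  rw [h]
  refine Finset.sum_congr rfl fun p _ => ?_
  rw [altCoeff_apply, ← Equiv.sum_comp (Equiv.inv _) fun σ : Perm (Fin m) => (Perm.sign σ : ℤ) *
    (MvPolynomial.killCompl p.succAbove_right_injective g).coeff
      (Finsupp.equivFunOnFinite.symm fun i => (σ i : ℕ) + 1)]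
  simp only [Equiv.inv_apply, Perm.sign_inv]
  congr 1
  refine Finset.sum_congr rfl fun e _ => ?_
  rw [MvPolynomial.coeff_killCompl]
  congr 2
  ext i
  refine Fin.succAboveCases p ?_ (fun j => ?_) i
  · rw [Finsupp.mapDomain_of_notMem_range _ _ (by simp)]
    have : (consPerm p e).symm p = 0 := by rw [Equiv.symm_apply_eq, consPerm_zero]
    simp [this]
  · rw [Finsupp.mapDomain_apply p.succAbove_right_injective]
    have : (consPerm p e).symm (p.succAbove j) = (e.symm j).succ := by
      rw [Equiv.symm_apply_eq, consPerm_succ, Equiv.apply_symm_apply]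
    simp [this]

lemma coeff_prod_aeval_X {m : ℕ} (g : Fin m → Polynomial ℤ) (d : Fin m →₀ ℕ) :
    (∏ i, Polynomial.aeval (MvPolynomial.X i : MvPolynomial (Fin m) ℤ) (g i)).coeff d =
      ∏ i, (g i).coeff (d i) := by
  classical
  simp only [Polynomial.aeval_eq_sum_range]
  rw [Finset.prod_univ_sum, MvPolynomial.coeff_sum]
  have h (x : Fin m → ℕ) :
      (∏ i, (g i).coeff (x i) • (MvPolynomial.X i : MvPolynomial (Fin m) ℤ) ^ x i).coeff d
      = if Finsupp.equivFunOnFinite.symm x = d then ∏ i, (g i).coeff (x i) else 0 := by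
    rw [← MvPolynomial.coeff_monomial]
    rw [MvPolynomial.monomial_eq, Finsupp.prod_fintype _ _ (by simp)]
    simp [MvPolynomial.smul_eq_C_mul, Finset.prod_mul_distrib]
  simp only [h]
  rw [Finset.sum_eq_single (d : Fin m → ℕ)]
  · simp
  · intro b _ hb
    rw [if_neg]
    rintro rfl
    exact hb rfl
  · intro hd
    simp only [Fintype.mem_piFinset, Finset.mem_range, not_forall, not_lt] at hd
    obtain ⟨i, hi⟩ := hd
    rw [if_pos (by ext; simp)]
    exact Finset.prod_eq_zero (Finset.mem_univ i)
      (Polynomial.coeff_eq_zero_of_natDegree_lt (by omega))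

lemma rename_ascProd {m : ℕ} (σ : Perm (Fin m)) :
    MvPolynomial.rename σ (ascProd MvPolynomial.X : MvPolynomial (Fin m) ℤ) =
      ascProd (MvPolynomial.X ∘ σ) := by
  simp only [ascProd, map_prod, apply_ite (MvPolynomial.rename σ), map_add, map_mul, map_one,
    MvPolynomial.rename_X, Function.comp_apply]

lemma aeval_twoVarPoly {R A : Type*} [CommRing R] [CommRing A] [Algebra R A] (n j : ℕ) (x : A) :
    Polynomial.aeval x (twoVarPoly n j (Polynomial.X : Polynomial R)) = twoVarPoly n j x := by
  simp [twoVarPoly]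

theorem altCoeff_ascProd_eq_det (n : ℕ) :
    altCoeff 0 n (ascProd MvPolynomial.X * ∏ i : Fin n, (1 + MvPolynomial.X i) ^ (i : ℕ)) =
      (Matrix.of fun i j : Fin n =>
        (twoVarPoly n j (Polynomial.X : Polynomial ℤ)).coeff i).det := by
  have h := congrArg (MvPolynomial.coeff (Finsupp.equivFunOnFinite.symm fun i : Fin n => (i : ℕ)))
    (sum_sign_ascProd_eq_det n (MvPolynomial.X : Fin n → MvPolynomial (Fin n) ℤ))
  have hC (z : ℤ) : (z : MvPolynomial (Fin n) ℤ) = MvPolynomial.C z := by simp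
  rw [← Matrix.det_transpose, Matrix.det_apply', MvPolynomial.coeff_sum, MvPolynomial.coeff_sum] at h
  rw [← Matrix.det_transpose, Matrix.det_apply', altCoeff_apply]
  refine Eq.trans (Finset.sum_congr rfl fun σ _ => ?_) (h.trans (Finset.sum_congr rfl fun σ _ => ?_))
  · have : (∏ i : Fin n, (1 + MvPolynomial.X (σ i)) ^ (i : ℕ) : MvPolynomial (Fin n) ℤ) =
        MvPolynomial.rename σ (∏ i : Fin n, (1 + MvPolynomial.X i) ^ (i : ℕ)) := by simp
    rw [hC, MvPolynomial.coeff_C_mul, this, ← rename_ascProd, ← map_mul, coeff_rename_perm]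
    rfl
  · simp only [Matrix.transpose_apply, Matrix.of_apply]
    rw [hC, MvPolynomial.coeff_C_mul,
      ← Finset.prod_congr rfl fun i _ => aeval_twoVarPoly (R := ℤ) n (σ i) (MvPolynomial.X i),
      coeff_prod_aeval_X]
    rfl

end AltCoeff

section Interlacing

open Equiv

/-- The prefix counts of `S'` and `S` up to `N` differ by `0` or `1`. -/
def Interlace (N : ℕ) (S' S : Finset ℕ) : Prop :=
  ∀ k ≤ N, Nat.count (· ∈ S') k ≤ Nat.count (· ∈ S) k ∧
    Nat.count (· ∈ S) k ≤ Nat.count (· ∈ S') k + 1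

instance (N : ℕ) (S' S : Finset ℕ) : Decidable (Interlace N S' S) :=
  inferInstanceAs (Decidable (∀ k ≤ N, _))

lemma interlace_succ {N : ℕ} {S' S : Finset ℕ} : Interlace (N + 1) S' S ↔
    Interlace N S' S ∧ Nat.count (· ∈ S') (N + 1) ≤ Nat.count (· ∈ S) (N + 1) ∧
    Nat.count (· ∈ S) (N + 1) ≤ Nat.count (· ∈ S') (N + 1) + 1 := by
  refine ⟨fun h => ⟨fun k hk => h k (by omega), h _ le_rfl⟩, fun h k hk => ?_⟩
  rcases hk.lt_or_eq with hk | rfl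
  · exact h.1 k (by omega)
  · exact h.2

section Scan

variable {R : Type*} [CommRing R] (u : ℕ → R)

/-- The product of `u i ^ l i`, where `l 0 < l 1 < ...` are the elements of `S`. -/
def weight (S : Finset ℕ) : R := ∏ e ∈ S, u (Nat.count (· ∈ S) e) ^ e

/-- The weighted sum over all subsets of `range N` interlacing with `S` and having `d` fewer
elements below `N`. -/
def scanSum (S : Finset ℕ) (d N : ℕ) : R :=
  ∑ S' ∈ (Finset.range N).powerset,
    if Interlace N S' S ∧ Nat.count (· ∈ S) N = Nat.count (· ∈ S') N + d then weight u S' else 0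

lemma count_insert {N k : ℕ} (hk : k ≤ N) (S : Finset ℕ) :
    Nat.count (· ∈ insert N S) k = Nat.count (· ∈ S) k := by
  rw [Nat.count_eq_card_filter_range, Nat.count_eq_card_filter_range]
  congr 1
  refine Finset.filter_congr fun x hx => ?_
  have : x ≠ N := by have := Finset.mem_range.1 hx; omega
  simp [this]

lemma interlace_insert {N : ℕ} {S' S : Finset ℕ} :
    Interlace N (insert N S') S ↔ Interlace N S' S :=
  forall₂_congr fun k hk => by rw [count_insert hk]

lemma weight_insert {N : ℕ} {S : Finset ℕ} (hS : S ⊆ Finset.range N) :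
    weight u (insert N S) = weight u S * u (Nat.count (· ∈ S) N) ^ N := by
  have hN : N ∉ S := fun h => by simpa using hS h
  rw [weight, Finset.prod_insert hN, mul_comm, count_insert le_rfl, weight]
  congr 1
  refine Finset.prod_congr rfl fun e he => ?_
  rw [count_insert (Finset.mem_range.1 (hS he)).le]

lemma scanSum_succ (S : Finset ℕ) (d N : ℕ) (hd : d ≤ 1) : scanSum u S d (N + 1) =
    ∑ S' ∈ (Finset.range N).powerset, ((if Interlace N S' S ∧
      Nat.count (· ∈ S) (N + 1) = Nat.count (· ∈ S') N + d then weight u S' else 0) +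
      if Interlace N S' S ∧ Nat.count (· ∈ S) (N + 1) = Nat.count (· ∈ S') N + 1 + d then
        weight u S' * u (Nat.count (· ∈ S') N) ^ N else 0) := by
  rw [scanSum, Finset.range_add_one, Finset.sum_powerset_insert Finset.notMem_range_self,
    ← Finset.sum_add_distrib]
  refine Finset.sum_congr rfl fun S' hS' => ?_
  have hS' := Finset.mem_powerset.1 hS'
  have hN : N ∉ S' := fun h => by simpa using hS' h
  have h1 : Nat.count (· ∈ S') (N + 1) = Nat.count (· ∈ S') N := by simp [Nat.count_succ, hN]
  have h2 : Nat.count (· ∈ insert N S') (N + 1) = Nat.count (· ∈ S') N + 1 := by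
    rw [Nat.count_succ, count_insert le_rfl, if_pos (Finset.mem_insert_self _ _)]
  simp only [interlace_succ, interlace_insert, h1, h2, weight_insert u hS']
  congr 1
  · refine if_congr ⟨fun h => ⟨h.1.1, h.2⟩, fun h => ⟨⟨h.1, ?_⟩, h.2⟩⟩ rfl rfl
    omega
  · refine if_congr ⟨fun h => ⟨h.1.1, h.2⟩, fun h => ⟨⟨h.1, ?_⟩, h.2⟩⟩ rfl rfl
    omega

variable {S : Finset ℕ} {N : ℕ}

lemma scanSum_zero_succ_of_notMem (hN : N ∉ S) : scanSum u S 0 (N + 1) =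
    scanSum u S 0 N + scanSum u S 1 N * u (Nat.count (· ∈ S) N - 1) ^ N := by
  rw [scanSum_succ _ _ _ _ zero_le_one, Finset.sum_add_distrib, scanSum, scanSum, Finset.sum_mul]
  simp only [Nat.count_succ, hN, if_false, add_zero, ite_mul, zero_mul]
  congr 1
  refine Finset.sum_congr rfl fun S' _ => ?_
  split_ifs with h
  · rw [h.2, Nat.add_sub_cancel]
  · rfl

lemma scanSum_one_succ_of_notMem (hN : N ∉ S) : scanSum u S 1 (N + 1) = scanSum u S 1 N := by
  rw [scanSum_succ _ _ _ _ le_rfl, scanSum]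
  refine Finset.sum_congr rfl fun S' _ => ?_
  simp only [Nat.count_succ, hN, if_false, add_zero]
  rw [add_eq_left, if_neg]
  rintro ⟨h, h'⟩
  have := h N le_rfl
  omega

lemma scanSum_zero_succ_of_mem (hN : N ∈ S) : scanSum u S 0 (N + 1) =
    scanSum u S 0 N * u (Nat.count (· ∈ S) N) ^ N := by
  rw [scanSum_succ _ _ _ _ zero_le_one, scanSum, Finset.sum_mul]
  refine Finset.sum_congr rfl fun S' _ => ?_
  simp only [Nat.count_succ, hN, if_true, add_zero, Nat.add_right_cancel_iff]
  rw [if_neg, zero_add]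
  · split_ifs with h
    · rw [h.2]
    · rw [zero_mul]
  · rintro ⟨h, h'⟩
    have := h N le_rfl
    omega

lemma scanSum_one_succ_of_mem (hN : N ∈ S) : scanSum u S 1 (N + 1) =
    scanSum u S 0 N + scanSum u S 1 N * u (Nat.count (· ∈ S) N - 1) ^ N := by
  rw [scanSum_succ _ _ _ _ le_rfl, Finset.sum_add_distrib, scanSum, scanSum, Finset.sum_mul]
  simp only [Nat.count_succ, hN, if_true, add_zero, Nat.add_right_cancel_iff, ite_mul, zero_mul]
  congr 1
  refine Finset.sum_congr rfl fun S' _ => ?_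
  split_ifs with h
  · rw [h.2, Nat.add_sub_cancel]
  · rfl

lemma scanSum_one_of_count_eq_zero (h : Nat.count (· ∈ S) N = 0) : scanSum u S 1 N = 0 :=
  Finset.sum_eq_zero fun S' _ => if_neg (by omega)

/-- The alternating sum, over the omitted index `p`, of the boundary terms of the telescoping box
sum `∑ l, ∏ i < d, u i ^ l i` with `k i ≤ l i ≤ k (i + 1)`. -/
def boundarySum (k : ℕ → ℕ) (d : ℕ) : R :=
  ∑ p ∈ Finset.range (d + 1), (-1) ^ p *
    ∏ i ∈ Finset.range d, if i < p then u i ^ k i else u i ^ (k (i + 1) + 1)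

lemma boundarySum_succ (k : ℕ → ℕ) (d : ℕ) : boundarySum u k (d + 1) =
    boundarySum u k d * u d ^ (k (d + 1) + 1) +
      (-1) ^ (d + 1) * ∏ i ∈ Finset.range (d + 1), u i ^ k i := by
  rw [boundarySum, Finset.sum_range_succ, boundarySum, Finset.sum_mul]
  congr 1
  · refine Finset.sum_congr rfl fun p hp => ?_
    rw [Finset.prod_range_succ, if_neg (by simpa [Nat.lt_succ_iff] using hp), mul_assoc]
  · congr 1
    exact Finset.prod_congr rfl fun i hi => if_pos (Finset.mem_range.1 hi)

end Scan

open MvPolynomial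

/-- The span of the polynomials `(1 + X j + X j * X (j + 1)) * h` with `j + 1 < c` and `h`
symmetric in `X j` and `X (j + 1)`. -/
noncomputable def swapSpan (c : ℕ) : Submodule ℤ (MvPolynomial ℕ ℤ) :=
  Submodule.span ℤ {p | ∃ j h, j + 1 < c ∧ rename (swap j (j + 1)) h = h ∧
    p = (1 + X j + X j * X (j + 1)) * h}

lemma swapSpan_mono {c c' : ℕ} (h : c ≤ c') : swapSpan c ≤ swapSpan c' :=
  Submodule.span_mono fun _ ⟨j, g, hj, hg⟩ => ⟨j, g, by omega, hg⟩

lemma mul_mem_swapSpan {c : ℕ} {p g : MvPolynomial ℕ ℤ} (hp : p ∈ swapSpan c)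
    (hg : ∀ j, j + 1 < c → rename (swap j (j + 1)) g = g) : p * g ∈ swapSpan c := by
  induction hp using Submodule.span_induction with
  | mem p hp =>
    obtain ⟨j, h, hj, hh, rfl⟩ := hp
    exact Submodule.subset_span ⟨j, h * g, hj, by rw [map_mul, hh, hg j hj], by ring⟩
  | zero => simp
  | add p q _ _ hp hq => rw [add_mul]; exact add_mem hp hq
  | smul a p _ hp => rw [smul_mul_assoc]; exact Submodule.smul_mem _ _ hp

/-- The variable shifted by `1`. -/
noncomputable def shiftX (i : ℕ) : MvPolynomial ℕ ℤ := 1 + X i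

lemma rename_swap_X {j i : ℕ} (h : i ≠ j) (h' : i ≠ j + 1) :
    rename (swap j (j + 1)) (X i : MvPolynomial ℕ ℤ) = X i := by
  rw [rename_X, swap_apply_of_ne_of_ne h h']

lemma rename_swap_shiftX {j i : ℕ} (h : i ≠ j) (h' : i ≠ j + 1) :
    rename (swap j (j + 1)) (shiftX i) = shiftX i := by
  rw [shiftX, map_add, rename_swap_X h h', map_one]

lemma rename_swap_boundarySum (k : ℕ → ℕ) (d : ℕ) :
    rename (swap d (d + 1)) (boundarySum shiftX k d) = boundarySum shiftX k d := by
  simp only [boundarySum, map_sum, map_mul, map_pow, map_neg, map_one, map_prod]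
  refine Finset.sum_congr rfl fun p _ => congrArg _ (Finset.prod_congr rfl fun i hi => ?_)
  have := Finset.mem_range.1 hi
  rw [apply_ite (rename (swap d (d + 1))), map_pow, map_pow,
    rename_swap_shiftX (by omega) (by omega)]

lemma shiftX_eq (i : ℕ) : shiftX i = 1 + X i := rfl

section

variable {R : Type*} [CommRing R] {N : ℕ}

lemma step_mem_one (a s t b x y m : R) (hy : y = 1 + x) :
    a * x * (s + t * y ^ N) - (b * y ^ (N + 1) + m) =
      (a * x * s - (b * y ^ N + m)) + (a * t - b) * (x * y ^ N) := by
  rw [pow_succ, show y ^ N * y = y ^ N * (1 + x) by rw [hy]]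
  ring

lemma step_mem_zero (a s b x x' y y' e m : R) (hy : y = 1 + x) (hy' : y' = 1 + x') :
    a * x' * (s * y' ^ N) -
      ((b * y ^ (N + 1) + e * m) * y' ^ (N + 1) + e * -1 * (m * y' ^ N)) =
      (a * s - (b * y ^ N + e * m)) * (x' * y' ^ N) -
        (1 + x + x * x') * (b * (y * y') ^ N) := by
  rw [mul_pow, pow_succ, pow_succ, show y ^ N * y = y ^ N * (1 + x) by rw [hy],
    show y' ^ N * y' = y' ^ N * (1 + x') by rw [hy']]
  ring

end

set_option maxHeartbeats 1000000 in
theorem scanSum_sub_mem_swapSpan (S : Finset ℕ) (k : ℕ → ℕ)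
    (hk : ∀ N ∈ S, k (Nat.count (· ∈ S) N) = N) (N : ℕ) :
    (Nat.count (· ∈ S) N = 0 → scanSum shiftX S 0 N = 1) ∧
    ∀ d, Nat.count (· ∈ S) N = d + 1 →
      (∏ i ∈ Finset.range d, X i) * scanSum shiftX S 1 N - boundarySum shiftX k d ∈ swapSpan d ∧
      (∏ i ∈ Finset.range (d + 1), X i) * scanSum shiftX S 0 N -
        (boundarySum shiftX k d * shiftX d ^ N +
          (-1) ^ (d + 1) * ∏ i ∈ Finset.range (d + 1), shiftX i ^ k i) ∈ swapSpan (d + 1) := by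
  induction N with
  | zero =>
    simp [scanSum, weight, Interlace]
  | succ N ih =>
    obtain ⟨ih0, ih⟩ := ih
    by_cases hN : N ∈ S
    · have hc : Nat.count (· ∈ S) (N + 1) = Nat.count (· ∈ S) N + 1 := by
        simp [Nat.count_succ, hN]
      refine ⟨by omega, fun d hd => ?_⟩
      have hkN := hk N hN
      rw [scanSum_zero_succ_of_mem _ hN, scanSum_one_succ_of_mem _ hN]
      obtain rfl : d = Nat.count (· ∈ S) N := by omega
      rcases hd : Nat.count (· ∈ S) N with _ | d
      · rw [hd] at hkN
        rw [ih0 hd, scanSum_one_of_count_eq_zero _ hd]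
        have h1 : boundarySum shiftX k 0 = 1 := by simp [boundarySum]
        refine ⟨by simp [h1], ?_⟩
        convert zero_mem (swapSpan (0 + 1)) using 1
        simp [h1, hkN, shiftX]
        ring
      · obtain ⟨ih1, ih2⟩ := ih d hd
        rw [hd] at hkN
        rw [Nat.add_sub_cancel]
        have hgen : (1 + X d + X d * X (d + 1)) *
            (boundarySum shiftX k d * (shiftX d * shiftX (d + 1)) ^ N) ∈ swapSpan (d + 2) := by
          refine Submodule.subset_span ⟨d, _, by omega, ?_, rfl⟩
          rw [map_mul, rename_swap_boundarySum, map_pow, map_mul, shiftX, shiftX]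
          simp [mul_comm]
        have ih1' := mul_mem_swapSpan ih1 (g := X d * shiftX d ^ N) fun j hj => by
          rw [map_mul, map_pow, rename_swap_X (by omega) (by omega),
            rename_swap_shiftX (by omega) (by omega)]
        have ih2' := mul_mem_swapSpan ih2 (g := X (d + 1) * shiftX (d + 1) ^ N) fun j hj => by
          rw [map_mul, map_pow, rename_swap_X (by omega) (by omega),
            rename_swap_shiftX (by omega) (by omega)]
        have hsub := swapSpan_mono (show d ≤ d + 1 by omega) ih1'
        constructor
        · rw [boundarySum_succ, hkN, Finset.prod_range_succ X d,
            step_mem_one _ _ _ _ _ _ _ (shiftX_eq d), ← Finset.prod_range_succ]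
          exact add_mem ih2 hsub
        · rw [boundarySum_succ, hkN, Finset.prod_range_succ X (d + 1),
            Finset.prod_range_succ (fun i => shiftX i ^ k i) (d + 1), hkN, pow_succ (-1) (d + 1),
            step_mem_zero _ _ _ _ _ _ _ _ _ (shiftX_eq d) (shiftX_eq (d + 1))]
          exact sub_mem (swapSpan_mono (show d + 1 ≤ d + 2 by omega) ih2') hgen
    · have hc : Nat.count (· ∈ S) (N + 1) = Nat.count (· ∈ S) N := by
        simp [Nat.count_succ, hN]
      rw [hc, scanSum_zero_succ_of_notMem _ hN, scanSum_one_succ_of_notMem _ hN]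
      refine ⟨fun h => ?_, fun d hd => ⟨(ih d hd).1, ?_⟩⟩
      · rw [ih0 h, scanSum_one_of_count_eq_zero _ h, zero_mul, add_zero]
      · have ih1' := mul_mem_swapSpan (ih d hd).1 (g := X d * shiftX d ^ N) fun j hj => by
          rw [map_mul, map_pow, rename_swap_X (by omega) (by omega),
            rename_swap_shiftX (by omega) (by omega)]
        rw [hd, Nat.add_sub_cancel, Finset.prod_range_succ X d,
          step_mem_one _ _ _ _ _ _ _ (shiftX_eq d), ← Finset.prod_range_succ]
        exact add_mem (ih d hd).2 (swapSpan_mono (show d ≤ d + 1 by omega) ih1')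

end Interlacing

section PathCount

open Equiv

lemma map_ascProd {R A F : Type*} [CommRing R] [CommRing A] [FunLike F R A] [RingHomClass F R A]
    (f : F) {n : ℕ} (x : Fin n → R) : f (ascProd x) = ascProd (f ∘ x) := by
  simp only [ascProd, map_prod, apply_ite f, map_add, map_mul, map_one, Function.comp_apply]

lemma ascProd_comp_swap_mul {R : Type*} [CommRing R] {n : ℕ} (x : Fin n → R) {a b : Fin n}
    (hab : (b : ℕ) = a + 1) :
    ascProd (x ∘ swap a b) * (1 + x b + x a * x b) = ascProd x * (1 + x a + x a * x b) := by
  have h1 : ascProd (x ∘ swap a b) = ∏ p : Fin n × Fin n,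
      if swap a b p.1 < swap a b p.2 then 1 + x p.2 + x p.1 * x p.2 else 1 := by
    rw [← Equiv.prod_comp ((swap a b).prodCongr (swap a b)), Fintype.prod_prod_type]
    simp [ascProd]
  have h2 : ascProd x = ∏ p : Fin n × Fin n,
      if p.1 < p.2 then 1 + x p.2 + x p.1 * x p.2 else 1 := by
    rw [Fintype.prod_prod_type, ascProd]
  have h3 : 1 + x b + x a * x b =
      ∏ p : Fin n × Fin n, if p = (a, b) then 1 + x b + x a * x b else 1 := by simp
  have h4 : 1 + x a + x a * x b =
      ∏ p : Fin n × Fin n, if p = (b, a) then 1 + x a + x a * x b else 1 := by simp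
  rw [h1, h2, h3, h4, ← Finset.prod_mul_distrib, ← Finset.prod_mul_distrib]
  refine Finset.prod_congr rfl fun ⟨i, j⟩ _ => ?_
  have hne : a ≠ b := by rintro rfl; omega
  simp only [Prod.mk.injEq]
  by_cases hA : i = a ∧ j = b
  · obtain ⟨rfl, rfl⟩ := hA
    have h : ¬ j < i := by rw [Fin.lt_def]; omega
    have h' : i < j := by rw [Fin.lt_def]; omega
    simp [h, h', hne]
  by_cases hB : i = b ∧ j = a
  · obtain ⟨rfl, rfl⟩ := hB
    have h : ¬ i < j := by rw [Fin.lt_def]; omega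
    have h' : j < i := by rw [Fin.lt_def]; omega
    simp [h, h', hne, mul_comm]
  rw [if_neg hA, if_neg hB, mul_one, mul_one]
  refine if_congr ?_ rfl rfl
  simp only [swap_apply_def, Fin.lt_def, Fin.ext_iff] at *
  split_ifs <;> omega

lemma ascProd_of_eq_zero {R : Type*} [CommRing R] {n : ℕ} (x : Fin (n + 1) → R)
    (p : Fin (n + 1)) (hp : x p = 0) : ascProd x = ascProd (x ∘ p.succAbove) *
      ∏ j, if p < p.succAbove j then 1 + x (p.succAbove j) else 1 := by
  rw [ascProd, Fin.prod_univ_succAbove _ p]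
  simp only [Fin.prod_univ_succAbove _ p, hp, lt_irrefl, one_mul, zero_mul, mul_zero,
    add_zero, ite_self, Fin.succAbove_lt_succAbove_iff]
  rw [mul_comm]
  rfl

open MvPolynomial

/-- Setting the variables with index at least `m` to zero. -/
noncomputable def truncVars (m : ℕ) : MvPolynomial ℕ ℤ →ₐ[ℤ] MvPolynomial (Fin m) ℤ :=
  killCompl Fin.val_injective

lemma truncVars_X {m : ℕ} (i : Fin m) : truncVars m (X (i : ℕ)) = X i := by
  rw [truncVars, ← rename_X (Fin.val : Fin m → ℕ), killCompl_rename_app]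

lemma truncVars_X_of_le {m i : ℕ} (h : m ≤ i) : truncVars m (X i) = 0 := by
  rw [truncVars, killCompl, aeval_X, dif_neg]
  rintro ⟨j, rfl⟩
  exact absurd j.2 (by omega)

lemma truncVars_shiftX {m : ℕ} (i : Fin m) : truncVars m (shiftX i) = 1 + X i := by
  rw [shiftX, map_add, map_one, truncVars_X]

lemma rename_swap_truncVars {m : ℕ} (a b : Fin m) (h : MvPolynomial ℕ ℤ) :
    rename (swap a b) (truncVars m h) = truncVars m (rename (swap (a : ℕ) b) h) := by
  refine DFunLike.congr_fun (f := (rename (swap a b)).comp (truncVars m))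
    (g := (truncVars m).comp (rename (swap (a : ℕ) b))) (algHom_ext fun i => ?_) h
  rw [AlgHom.comp_apply, AlgHom.comp_apply, rename_X]
  by_cases hi : i < m
  · rw [truncVars_X ⟨i, hi⟩, rename_X, ← truncVars_X]
    congr 2
    simp only [swap_apply_def, Fin.ext_iff]
    split_ifs <;> rfl
  · rw [truncVars_X_of_le (by omega), swap_apply_of_ne_of_ne (by omega) (by omega),
      truncVars_X_of_le (by omega), map_zero]

lemma altCoeff_eq_zero_of_mem_swapSpan (s : ℕ) {m : ℕ} {p : MvPolynomial ℕ ℤ}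
    (hp : p ∈ swapSpan m) : altCoeff s m (ascProd X * truncVars m p) = 0 := by
  induction hp using Submodule.span_induction with
  | mem p hp =>
    obtain ⟨j, h, hj, hh, rfl⟩ := hp
    obtain ⟨a, ha⟩ : ∃ a : Fin m, (a : ℕ) = j := ⟨⟨j, by omega⟩, rfl⟩
    obtain ⟨b, hb⟩ : ∃ b : Fin m, (b : ℕ) = a + 1 := ⟨⟨a + 1, by omega⟩, rfl⟩
    subst ha
    rw [← hb] at hh ⊢
    refine altCoeff_eq_zero_of_rename_swap (i := a) (j := b) (by rintro rfl; omega) ?_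
    rw [map_mul (truncVars m), map_mul, map_mul, rename_swap_truncVars a b h, hh, ← mul_assoc,
      ← mul_assoc]
    congr 1
    simp only [map_add, map_mul, map_one, truncVars_X, rename_X, swap_apply_left,
      swap_apply_right, rename_ascProd]
    rw [mul_comm (X b) (X a)]
    exact ascProd_comp_swap_mul X hb
  | zero => simp
  | add p q _ _ hp hq => rw [map_add, mul_add, map_add, hp, hq, add_zero]
  | smul a p _ hp => rw [map_smul, mul_smul_comm, map_smul, hp, smul_zero]

lemma count_mem_eq_card {n : ℕ} {S : Finset ℕ} (hS : S ⊆ Finset.range n) :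
    Nat.count (· ∈ S) n = S.card := by
  rw [Nat.count_eq_card_filter_range, Finset.filter_mem_eq_inter,
    Finset.inter_eq_right.2 hS]

lemma weight_eq_prod_nth {R : Type*} [CommRing R] (u : ℕ → R) (S : Finset ℕ) :
    weight u S = ∏ i ∈ Finset.range S.card, u i ^ Nat.nth (· ∈ S) i := by
  have hf : {e | e ∈ S}.Finite := S.finite_toSet
  have hc : hf.toFinset = S := by ext; simp
  refine Finset.prod_nbij' (fun e => Nat.count (· ∈ S) e) (fun i => Nat.nth (· ∈ S) i) ?_ ?_ ?_ ?_ ?_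
  · intro e he
    have := Nat.count_lt_card hf he
    rwa [hc, ← Finset.mem_range] at this
  · intro i hi
    exact Nat.nth_mem_of_lt_card hf (by rwa [hc, ← Finset.mem_range])
  · intro e he
    exact Nat.nth_count he
  · intro i hi
    exact Nat.count_nth_of_lt_card_finite hf (by rwa [hc, ← Finset.mem_range])
  · intro e he
    rw [Nat.nth_count he]

lemma killCompl_ascProd_mul {m : ℕ} (k : ℕ → ℕ) (p : Fin (m + 1)) :
    killCompl p.succAbove_right_injective
      (ascProd X * ∏ i : Fin (m + 1), (1 + X i) ^ k i : MvPolynomial (Fin (m + 1)) ℤ) =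
      ascProd X * ∏ i : Fin m,
        if (i : ℕ) < p then (1 + X i) ^ k i else (1 + X i) ^ (k (i + 1) + 1) := by
  have hp : killCompl p.succAbove_right_injective (X p : MvPolynomial (Fin (m + 1)) ℤ) = 0 := by
    rw [killCompl, aeval_X, dif_neg (by simp)]
  have hs (j : Fin m) : killCompl p.succAbove_right_injective
      (X (p.succAbove j) : MvPolynomial (Fin (m + 1)) ℤ) = X j := by
    rw [← rename_X p.succAbove, killCompl_rename_app]
  rw [map_mul, map_ascProd, ascProd_of_eq_zero _ p hp, map_prod, Fin.prod_univ_succAbove _ p,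
    mul_assoc]
  congr 1
  · congr 1
    exact funext hs
  · simp only [map_pow, map_add, map_one, hp, hs, add_zero, one_pow, one_mul, Function.comp_apply]
    rw [← Finset.prod_mul_distrib]
    refine Finset.prod_congr rfl fun i _ => ?_
    by_cases h : (i : ℕ) < p
    · have h' : i.castSucc < p := h
      rw [Fin.succAbove_of_castSucc_lt _ _ h', if_pos h, if_neg h'.not_gt, one_mul]
      rfl
    · have h' : p ≤ i.castSucc := Fin.le_def.2 (by simpa using h)
      rw [Fin.succAbove_of_le_castSucc _ _ h', if_neg h, if_pos (Fin.le_castSucc_iff.1 h'),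
        Fin.val_succ, pow_succ, mul_comm]

/-- The number of chains of `m` interlacing steps from the empty set to `S`, each adding one
element below `n`. -/
def pathCount (n : ℕ) : ℕ → Finset ℕ → ℕ
  | 0, S => if S = ∅ then 1 else 0
  | m + 1, S => ∑ S' ∈ (Finset.range n).powerset,
      if Interlace n S' S ∧ Nat.count (· ∈ S) n = Nat.count (· ∈ S') n + 1 then
        pathCount n m S' else 0

lemma truncVars_boundarySum (k : ℕ → ℕ) (m : ℕ) : truncVars m (boundarySum shiftX k m) =
    ∑ p : Fin (m + 1), (-1) ^ (p : ℕ) * ∏ i : Fin m,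
      if (i : ℕ) < p then (1 + X i) ^ k i else (1 + X i) ^ (k (i + 1) + 1) := by
  rw [boundarySum, Finset.sum_range, map_sum]
  refine Finset.sum_congr rfl fun p _ => ?_
  rw [map_mul, map_pow, map_neg, map_one, Finset.prod_range, map_prod]
  simp only [apply_ite (truncVars m), map_pow, truncVars_shiftX]

theorem pathCount_eq_altCoeff (n m : ℕ) (S : Finset ℕ) (hS : S ⊆ Finset.range n)
    (hm : S.card = m) : (pathCount n m S : ℤ) =
      altCoeff 0 m (ascProd X * truncVars m (weight shiftX S)) := by
  induction m generalizing S with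
  | zero =>
    obtain rfl := Finset.card_eq_zero.1 hm
    simp [pathCount, ascProd, weight, altCoeff_apply, coeff_one, Subsingleton.elim _ (0 : Fin 0 →₀ ℕ)]
  | succ m ih =>
    have hScard := count_mem_eq_card hS
    have hscan : (pathCount n (m + 1) S : ℤ) =
        altCoeff 0 m (ascProd X * truncVars m (scanSum shiftX S 1 n)) := by
      rw [pathCount, scanSum, map_sum, Finset.mul_sum, map_sum, Nat.cast_sum]
      refine Finset.sum_congr rfl fun S' hS' => ?_
      have hS' := Finset.mem_powerset.1 hS'
      split_ifs with h
      · refine ih S' hS' ?_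
        have := h.2
        rw [count_mem_eq_card hS'] at this
        omega
      · simp
    have hmem := ((scanSum_sub_mem_swapSpan S (Nat.nth (· ∈ S)) (fun N hN => Nat.nth_count hN)
      n).2 m (by omega)).1
    have hker := altCoeff_eq_zero_of_mem_swapSpan 1 hmem
    rw [map_sub, mul_sub, map_sub, sub_eq_zero, map_mul (truncVars m), map_prod, Finset.prod_range] at hker
    simp only [truncVars_X] at hker
    have hw : truncVars (m + 1) (weight shiftX S) =
        ∏ i : Fin (m + 1), (1 + X i) ^ Nat.nth (· ∈ S) i := by
      rw [weight_eq_prod_nth, hm, Finset.prod_range, map_prod]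
      simp only [map_pow, truncVars_shiftX]
    rw [hscan, ← altCoeff_prod_X_mul, mul_left_comm, hker, hw, altCoeff_succ,
      truncVars_boundarySum, Finset.mul_sum, map_sum]
    refine Finset.sum_congr rfl fun p _ => ?_
    rw [killCompl_ascProd_mul]
    have hsmul (g : MvPolynomial (Fin m) ℤ) : (-1) ^ (p : ℕ) * g = ((-1) ^ (p : ℕ) : ℤ) • g := by
      rw [zsmul_eq_mul]
      push_cast
      rfl
    rw [mul_left_comm, hsmul, map_smul, smul_eq_mul]

theorem pathCount_range_eq_det (n : ℕ) : (pathCount n n (Finset.range n) : ℤ) =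
    (Matrix.of fun i j : Fin n =>
        (twoVarPoly n j (Polynomial.X : Polynomial ℤ)).coeff i).det := by
  rw [← altCoeff_ascProd_eq_det, pathCount_eq_altCoeff n n _ subset_rfl (Finset.card_range n)]
  congr 2
  rw [weight, Finset.prod_range, map_prod]
  refine Finset.prod_congr rfl fun i _ => ?_
  have : Nat.count (· ∈ Finset.range n) (i : ℕ) = i := by
    rw [Nat.count_eq_card_filter_range, Finset.filter_mem_eq_inter, Finset.inter_eq_left.2 ?_,
      Finset.card_range]
    exact Finset.range_mono i.2.le
  rw [this, map_pow, truncVars_shiftX]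

end PathCount

section PartialASM

/-- The sum of the entries of `v` with index less than `k`. -/
def prefixSum {m : ℕ} (v : Fin m → ℤ) (k : ℕ) : ℤ := ∑ j : Fin m, if (j : ℕ) < k then v j else 0

lemma prefixSum_of_le {m k : ℕ} (v : Fin m → ℤ) (h : m ≤ k) : prefixSum v k = ∑ j, v j :=
  Finset.sum_congr rfl fun j _ => if_pos (by omega)

lemma prefixSum_snoc {m : ℕ} (v : Fin (m + 1) → ℤ) (k : ℕ) :
    prefixSum v k = prefixSum (fun i : Fin m => v i.castSucc) k +
      if m < k then v (Fin.last m) else 0 := by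
  rw [prefixSum, Fin.sum_univ_castSucc]
  rfl

lemma sum_filter_le_eq_prefixSum {m : ℕ} (v : Fin m → ℤ) (k : Fin m) :
    ∑ j ∈ Finset.univ.filter (fun j : Fin m => j ≤ k), v j = prefixSum v (k + 1) := by
  rw [Finset.sum_filter, prefixSum]
  refine Finset.sum_congr rfl fun j _ => if_congr ?_ rfl rfl
  rw [Fin.le_def, Nat.lt_succ_iff]

/-- The difference of the indicator functions of `S` and `S'` on `Fin n`. -/
def indicatorDiff (n : ℕ) (S S' : Finset ℕ) (j : Fin n) : ℤ :=
  (if (j : ℕ) ∈ S then 1 else 0) - if (j : ℕ) ∈ S' then 1 else 0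

lemma prefixSum_indicatorDiff {n k : ℕ} (S S' : Finset ℕ) (hk : k ≤ n) :
    prefixSum (indicatorDiff n S S') k = Nat.count (· ∈ S) k - Nat.count (· ∈ S') k := by
  have h (T : Finset ℕ) : (Nat.count (· ∈ T) k : ℤ) =
      ∑ j : Fin n, if (j : ℕ) < k then if (j : ℕ) ∈ T then 1 else 0 else 0 := by
    rw [Fin.sum_univ_eq_sum_range (fun j => if j < k then if j ∈ T then (1 : ℤ) else 0 else 0),
      ← Finset.sum_filter, Nat.count_eq_card_filter_range, Finset.card_filter, Nat.cast_sum]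
    refine Finset.sum_congr ?_ fun j _ => by split_ifs <;> rfl
    ext j
    simp only [Finset.mem_range, Finset.mem_filter]
    omega
  rw [h, h, ← Finset.sum_sub_distrib, prefixSum]
  refine Finset.sum_congr rfl fun j _ => ?_
  split_ifs <;> simp_all [indicatorDiff]

/-- `v` has total sum `1` and prefix sums in `{0, 1}`. -/
def IsASMRow {n : ℕ} (v : Fin n → ℤ) : Prop :=
  ∑ j, v j = 1 ∧ ∀ k, 0 ≤ prefixSum v k ∧ prefixSum v k ≤ 1

lemma isASMRow_indicatorDiff {n : ℕ} {S S' : Finset ℕ} : IsASMRow (indicatorDiff n S S') ↔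
    Interlace n S' S ∧ Nat.count (· ∈ S) n = Nat.count (· ∈ S') n + 1 := by
  have hn := prefixSum_indicatorDiff S S' (le_refl n)
  rw [prefixSum_of_le _ le_rfl] at hn
  rw [IsASMRow, hn]
  refine ⟨fun ⟨hc, h⟩ => ⟨fun k hk => ?_, by omega⟩, fun ⟨h, hc⟩ => ⟨by omega, fun k => ?_⟩⟩
  · have := h k
    rw [prefixSum_indicatorDiff _ _ hk] at this
    omega
  · rcases le_total k n with hk | hk
    · have := h k hk
      rw [prefixSum_indicatorDiff _ _ hk]
      omega
    · rw [prefixSum_of_le _ hk, hn]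
      omega

/-- The first `m` rows of an alternating sign matrix with `n` columns, with column sums given by
the indicator of `S`. -/
structure IsPartialASM (n m : ℕ) (S : Finset ℕ) (A : Fin m → Fin n → ℤ) : Prop where
  row : ∀ i, IsASMRow (A i)
  col_sum : ∀ j : Fin n, ∑ i, A i j = if (j : ℕ) ∈ S then 1 else 0
  col : ∀ j k, 0 ≤ prefixSum (fun i => A i j) k ∧ prefixSum (fun i => A i j) k ≤ 1

lemma IsPartialASM.snoc {n m : ℕ} {S S' : Finset ℕ} {A : Fin m → Fin n → ℤ}
    (hA : IsPartialASM n m S' A) (h : IsASMRow (indicatorDiff n S S')) :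
    IsPartialASM n (m + 1) S (Fin.snoc A (indicatorDiff n S S') : Fin (m + 1) → Fin n → ℤ) where
  row i := by
    refine Fin.lastCases ?_ (fun i => ?_) i
    · rwa [Fin.snoc_last]
    · rw [Fin.snoc_castSucc]
      exact hA.row i
  col_sum j := by
    rw [Fin.sum_univ_castSucc]
    simp only [Fin.snoc_castSucc, Fin.snoc_last, hA.col_sum, indicatorDiff]
    ring
  col j k := by
    rw [prefixSum_snoc]
    simp only [Fin.snoc_castSucc, Fin.snoc_last]
    split_ifs with hk
    · rw [prefixSum_of_le _ hk.le, hA.col_sum, indicatorDiff]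
      split_ifs <;> simp
    · simpa using hA.col j k

lemma IsPartialASM.exists_eq_snoc {n m : ℕ} {S : Finset ℕ} {A : Fin (m + 1) → Fin n → ℤ}
    (hA : IsPartialASM n (m + 1) S A) : ∃ S' ⊆ Finset.range n, ∃ B, IsPartialASM n m S' B ∧
      IsASMRow (indicatorDiff n S S') ∧ Fin.snoc B (indicatorDiff n S S') = A := by
  have hcol (j : Fin n) : 0 ≤ ∑ i : Fin m, A i.castSucc j ∧ ∑ i : Fin m, A i.castSucc j ≤ 1 := by
    have := hA.col j m
    rwa [prefixSum_snoc, if_neg (lt_irrefl m), add_zero, prefixSum_of_le _ le_rfl] at this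
  set S' : Finset ℕ := (Finset.univ.filter fun j : Fin n =>
    ∑ i : Fin m, A i.castSucc j = 1).map Fin.valEmbedding with hS'
  have hmem (j : Fin n) : (j : ℕ) ∈ S' ↔ ∑ i : Fin m, A i.castSucc j = 1 := by
    simp [hS', Fin.val_inj]
  have hsum (j : Fin n) : ∑ i : Fin m, A i.castSucc j = if (j : ℕ) ∈ S' then 1 else 0 := by
    have := hcol j
    split_ifs with h <;> rw [hmem] at h <;> omega
  have hlast : A (Fin.last m) = indicatorDiff n S S' := by
    ext j
    have := hA.col_sum j
    rw [Fin.sum_univ_castSucc, hsum] at this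
    rw [indicatorDiff, ← this]
    ring
  refine ⟨S', fun e he => ?_, fun i => A i.castSucc, ⟨fun i => hA.row _, hsum, fun j k => ?_⟩,
    hlast ▸ hA.row _, ?_⟩
  · obtain ⟨j, -, rfl⟩ := Finset.mem_map.1 he
    simp
  · rcases le_or_gt k m with hk | hk
    · have := hA.col j k
      rwa [prefixSum_snoc, if_neg (by omega), add_zero] at this
    · rw [prefixSum_of_le _ hk.le]
      exact hcol j
  · rw [← hlast]
    exact Fin.snoc_init_self A

lemma IsPartialASM.unique {n m : ℕ} {S T : Finset ℕ} {A : Fin m → Fin n → ℤ}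
    (hS : IsPartialASM n m S A) (hT : IsPartialASM n m T A) (hSn : S ⊆ Finset.range n)
    (hTn : T ⊆ Finset.range n) : S = T := by
  ext e
  by_cases he : e < n
  · have h := (hS.col_sum ⟨e, he⟩).symm.trans (hT.col_sum ⟨e, he⟩)
    by_cases h1 : e ∈ S <;> by_cases h2 : e ∈ T <;> simp_all
  · exact iff_of_false (fun h => he (by simpa using hSn h)) fun h => he (by simpa using hTn h)

theorem card_isPartialASM (n m : ℕ) (S : Finset ℕ) :
    Finite {A // IsPartialASM n m S A} ∧
      (S ⊆ Finset.range n → Nat.card {A // IsPartialASM n m S A} = pathCount n m S) := by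
  induction m generalizing S with
  | zero =>
    refine ⟨inferInstance, fun hS => ?_⟩
    rw [pathCount]
    split_ifs with h
    · rw [Nat.card_eq_one_iff_unique]
      refine ⟨inferInstance, ⟨⟨fun i => i.elim0, ⟨fun i => i.elim0, ?_, ?_⟩⟩⟩⟩
      · simp [h]
      · simp [prefixSum]
    · rw [Nat.card_eq_zero]
      refine Or.inl ⟨fun A => h ?_⟩
      refine Finset.eq_empty_of_forall_notMem fun e he => ?_
      have := A.2.col_sum ⟨e, by simpa using hS he⟩
      simp [he] at this
  | succ m ih =>
    set F := (Finset.range n).powerset.filter fun S' =>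
      Interlace n S' S ∧ Nat.count (· ∈ S) n = Nat.count (· ∈ S') n + 1 with hF
    have hrow (S' : F) : IsASMRow (indicatorDiff n S S') :=
      isASMRow_indicatorDiff.2 (Finset.mem_filter.1 S'.2).2
    have hsub (S' : F) : (S' : Finset ℕ) ⊆ Finset.range n :=
      Finset.mem_powerset.1 (Finset.mem_filter.1 S'.2).1
    let f : (Σ S' : F, {B // IsPartialASM n m S' B}) → {A // IsPartialASM n (m + 1) S A} :=
      fun x => ⟨Fin.snoc x.2.1 (indicatorDiff n S x.1), x.2.2.snoc (hrow x.1)⟩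
    have hf : Function.Bijective f := by
      constructor
      · rintro ⟨S', B, hB⟩ ⟨T', C, hC⟩ h
        obtain ⟨rfl, -⟩ := Fin.snoc_injective2 (α := fun _ => Fin n → ℤ) (congrArg Subtype.val h)
        obtain rfl : S' = T' := Subtype.ext (hB.unique hC (hsub S') (hsub T'))
        rfl
      · rintro ⟨A, hA⟩
        obtain ⟨S', hS', B, hB, hr, rfl⟩ := hA.exists_eq_snoc
        exact ⟨⟨⟨S', Finset.mem_filter.2 ⟨Finset.mem_powerset.2 hS',
          isASMRow_indicatorDiff.1 hr⟩⟩, B, hB⟩, rfl⟩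
    have hfin (S' : F) := (ih S').1
    refine ⟨Finite.of_surjective f hf.2, fun _ => ?_⟩
    rw [← Nat.card_congr (Equiv.ofBijective f hf), Nat.card_sigma, pathCount, ← Finset.sum_filter,
      ← hF, ← Finset.sum_coe_sort F]
    exact Finset.sum_congr rfl fun S' _ => (ih S').2 (hsub S')

lemma forall_prefixSum_iff {m : ℕ} (v : Fin m → ℤ) (hv : ∑ i, v i = 1) :
    (∀ k, 0 ≤ prefixSum v k ∧ prefixSum v k ≤ 1) ↔
      ∀ k : Fin m, 0 ≤ prefixSum v (k + 1) ∧ prefixSum v (k + 1) ≤ 1 := by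
  refine ⟨fun h k => h _, fun h k => ?_⟩
  rcases k with _ | k
  · simp [prefixSum]
  · rcases lt_or_ge k m with hk | hk
    · exact h ⟨k, hk⟩
    · rw [prefixSum_of_le _ (by omega), hv]
      simp

lemma prefixSum_succ {m : ℕ} (v : Fin m → ℤ) (i : Fin m) :
    prefixSum v (i + 1) = prefixSum v i + v i := by
  have : v i = ∑ j, if j = i then v j else 0 := by simp
  rw [this, prefixSum, prefixSum, ← Finset.sum_add_distrib]
  refine Finset.sum_congr rfl fun j _ => ?_
  simp only [Fin.ext_iff]
  split_ifs <;> omega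

lemma isASM_iff {n : ℕ} {A : Matrix (Fin n) (Fin n) ℤ} :
    IsASM n A ↔ IsPartialASM n n (Finset.range n) A := by
  simp only [IsASM, sum_filter_le_eq_prefixSum]
  constructor
  · rintro ⟨-, hr, hc, hr', hc'⟩
    exact ⟨fun i => ⟨hr i, (forall_prefixSum_iff _ (hr i)).2 (hr' i)⟩, fun j => by simp [hc],
      fun j => (forall_prefixSum_iff _ (hc j)).2 (hc' j)⟩
  · rintro ⟨hr, hc, hc'⟩
    refine ⟨fun i j => ?_, fun i => (hr i).1, fun j => by simp [hc], fun i k => (hr i).2 _,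
      fun j k => hc' j _⟩
    have h1 := (hr i).2 j
    have h2 := (hr i).2 (j + 1)
    rw [prefixSum_succ] at h2
    omega

theorem card_isASM (n : ℕ) :
    Nat.card {A : Matrix (Fin n) (Fin n) ℤ // IsASM n A} = pathCount n n (Finset.range n) := by
  rw [← (card_isPartialASM n n (Finset.range n)).2 subset_rfl]
  exact Nat.card_congr (Equiv.subtypeEquivRight fun _ => isASM_iff)

end PartialASM

section PowerSeriesDet

open PowerSeries

/-- The determinant of the first `n` coefficients of the first `n` power series `f j`. -/
noncomputable def coeffDet {K : Type*} [CommRing K] (n : ℕ) (f : ℕ → K⟦X⟧) : K :=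
  (Matrix.of fun i j : Fin n => coeff (i : ℕ) (f j)).det

lemma coeffDet_of_lowerTriangular {K : Type*} [CommRing K] {n : ℕ} {f g : ℕ → K⟦X⟧}
    (L : ℕ → ℕ → K) (hL : ∀ i k, i < k → L i k = 0)
    (h : ∀ i < n, ∀ j, coeff i (g j) = ∑ k ∈ Finset.range n, L i k * coeff k (f j)) :
    coeffDet n g = (∏ i : Fin n, L i i) * coeffDet n f := by
  have hM : (Matrix.of fun i j : Fin n => coeff (i : ℕ) (g j)) =
      (Matrix.of fun i k : Fin n => L i k) * Matrix.of fun i j : Fin n => coeff (i : ℕ) (f j) := by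
    ext i j
    rw [Matrix.mul_apply, Matrix.of_apply, h i i.2, Finset.sum_range]
    rfl
  have hdet : (Matrix.of fun i k : Fin n => L i k).det = ∏ i : Fin n, L i i :=
    Matrix.det_of_isLowerTriangular _ fun i k hik => hL i k hik
  rw [coeffDet, hM, Matrix.det_mul, hdet]
  rfl

lemma coeffDet_mul_left {K : Type*} [CommRing K] (n : ℕ) (w : K⟦X⟧) (f : ℕ → K⟦X⟧) :
    coeffDet n (fun j => w * f j) = constantCoeff w ^ n * coeffDet n f := by
  rw [coeffDet_of_lowerTriangular (f := f) (fun i k => if k ≤ i then coeff (i - k) w else 0)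
    (fun i k h => if_neg (by omega)) fun i hi j => ?_]
  · simp
  · rw [mul_comm, coeff_mul,
      Finset.Nat.sum_antidiagonal_eq_sum_range_succ fun a b => coeff a (f j) * coeff b w]
    simp only [ite_mul, zero_mul]
    rw [← Finset.sum_filter]
    refine Finset.sum_congr ?_ fun k _ => mul_comm _ _
    ext k
    simp only [Finset.mem_range, Finset.mem_filter]
    omega

lemma coeffDet_subst {K : Type*} [CommRing K] (n : ℕ) (w : K⟦X⟧) (f : ℕ → K⟦X⟧) :
    coeffDet n (fun j => (f j).subst (X * w)) =
      (∏ i : Fin n, constantCoeff w ^ (i : ℕ)) * coeffDet n f := by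
  have hs : HasSubst (X * w) := HasSubst.of_constantCoeff_zero' (by simp)
  have hc (i k : ℕ) : coeff i ((X * w) ^ k) = if k ≤ i then coeff (i - k) (w ^ k) else 0 := by
    rw [mul_pow, coeff_X_pow_mul']
  rw [coeffDet_of_lowerTriangular (f := f) (fun i k => coeff i ((X * w) ^ k))
    (fun i k h => by rw [hc, if_neg (by omega)]) fun i hi j => ?_]
  · simp [hc]
  · rw [coeff_subst' hs, finsum_eq_sum_of_support_subset]
    · exact Finset.sum_congr rfl fun k _ => by rw [smul_eq_mul, mul_comm]
    · intro k hk
      by_contra h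
      simp only [Finset.coe_range, Set.mem_Iio, not_lt] at h
      exact hk (by simp only [hc]; rw [if_neg (by omega), smul_zero])

lemma coeffDet_of_upperTriangular {K : Type*} [CommRing K] {n : ℕ} {f g : ℕ → K⟦X⟧}
    (U : ℕ → ℕ → K) (hU : ∀ k j, j < k → U k j = 0)
    (h : ∀ j < n, g j = ∑ k ∈ Finset.range n, C (U k j) * f k) :
    coeffDet n g = coeffDet n f * ∏ i : Fin n, U i i := by
  have hM : (Matrix.of fun i j : Fin n => coeff (i : ℕ) (g j)) =
      (Matrix.of fun i j : Fin n => coeff (i : ℕ) (f j)) * Matrix.of fun i k : Fin n => U i k := by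
    ext i j
    rw [Matrix.mul_apply, Matrix.of_apply, h j j.2, Finset.sum_range, map_sum]
    exact Finset.sum_congr rfl fun k _ => by rw [coeff_C_mul, mul_comm]; rfl
  have hdet : (Matrix.of fun k j : Fin n => U k j).det = ∏ i : Fin n, U i i :=
    Matrix.det_of_isUpperTriangular fun k j hkj => hU k j hkj
  rw [coeffDet, hM, Matrix.det_mul, hdet]
  rfl

lemma twoVarPoly_mul {R : Type*} [CommRing R] {n j : ℕ} (hj : j < n) {x w : R}
    (hw : (1 + x) * w = 1) : (1 + x + x ^ 2) * twoVarPoly n j x =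
      (1 + x) ^ n * (x ^ (j + 1) - (-w) ^ (j + 1)) := by
  obtain ⟨N, rfl⟩ : ∃ N, n = N + (j + 1) := ⟨n - (j + 1), by omega⟩
  have key (l : ℕ) : (1 + x + x ^ 2) * ∑ b ∈ Finset.range l, (1 + x) ^ (N + b) * (-x) ^ b =
      (1 + x) ^ N - (1 + x) ^ (N + l) * (-x) ^ l := by
    induction l with
    | zero => simp
    | succ l ih =>
      rw [Finset.sum_range_succ, mul_add, ih]
      ring
  rw [twoVarPoly, show N + (j + 1) - 1 - j = N by omega, mul_left_comm, key, mul_sub, pow_add _ N,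
    mul_sub, mul_assoc _ _ ((-w) ^ (j + 1)), ← mul_pow, mul_neg, hw, neg_pow x, pow_succ (-1 : R) j]
  have h1 : ((-1 : R) ^ j) * (-1) ^ j = 1 := by rw [← mul_pow]; simp
  linear_combination (1 + x) ^ N * (1 + x) ^ (j + 1) * x ^ (j + 1) * h1

lemma map_twoVarPoly {R A : Type*} [CommRing R] [CommRing A] (f : R →+* A) (n j : ℕ) (x : R) :
    f (twoVarPoly n j x) = twoVarPoly n j (f x) := by
  simp [twoVarPoly]

section

variable {K : Type*} [Field K]

/-- The power series `1 / (1 - c X)`. -/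
noncomputable def geomSeries (c : K) : K⟦X⟧ := rescale c (mk 1)

lemma one_sub_mul_geomSeries (c : K) : (1 - C c * X) * geomSeries c = 1 := by
  have := congrArg (rescale c) (mk_one_mul_one_sub_eq_one K)
  rwa [map_mul, map_sub, map_one, rescale_X, mul_comm] at this

lemma coeff_geomSeries_pow (c : K) (i j : ℕ) :
    coeff i (geomSeries c ^ (j + 1)) = c ^ i * (i + j).choose j := by
  rw [geomSeries, ← map_pow, coeff_rescale, mk_one_pow_eq_mk_choose_add, coeff_mk, add_comm]

lemma constantCoeff_geomSeries (c : K) : constantCoeff (geomSeries c) = 1 := by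
  simp [geomSeries, ← coeff_zero_eq_constantCoeff_apply]

lemma det_twoVarPoly_eq_coeffDet (n : ℕ) : (((Matrix.of fun i j : Fin n =>
      (twoVarPoly n j (Polynomial.X : Polynomial ℤ)).coeff i).det : ℤ) : K) =
    coeffDet n fun j => X ^ (j + 1) - (-geomSeries (-1 : K)) ^ (j + 1) := by
  have hw : (1 + X) * geomSeries (-1 : K) = 1 := by
    simpa using one_sub_mul_geomSeries (-1 : K)
  have h1 : (((Matrix.of fun i j : Fin n =>
      (twoVarPoly n j (Polynomial.X : Polynomial ℤ)).coeff i).det : ℤ) : K) =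
      coeffDet n fun j => twoVarPoly n j (X : K⟦X⟧) := by
    rw [← eq_intCast (Int.castRingHom K), RingHom.map_det, coeffDet]
    congr 1
    ext i j
    have := map_twoVarPoly ((Polynomial.coeToPowerSeries.ringHom (R := K)).comp
      (Polynomial.mapRingHom (Int.castRingHom K))) n j Polynomial.X
    simp only [RingHom.comp_apply, Polynomial.coe_mapRingHom, Polynomial.map_X,
      Polynomial.coeToPowerSeries.ringHom_apply, Polynomial.coe_X] at this
    simp [← this]
  have h2 := coeffDet_mul_left n (1 + X + X ^ 2 : K⟦X⟧) fun j => twoVarPoly n j X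
  have h3 := coeffDet_mul_left n ((1 + X) ^ n : K⟦X⟧)
    fun j => X ^ (j + 1) - (-geomSeries (-1 : K)) ^ (j + 1)
  have h4 : coeffDet n (fun j => (1 + X + X ^ 2 : K⟦X⟧) * twoVarPoly n j X) =
      coeffDet n fun j => (1 + X) ^ n * (X ^ (j + 1) - (-geomSeries (-1 : K)) ^ (j + 1)) := by
    rw [coeffDet, coeffDet]
    congr 1
    ext i j
    simp only [Matrix.of_apply, twoVarPoly_mul j.2 hw]
  rw [h2, h3] at h4
  simpa [h1] using h4

variable {q : K}

lemma C_sq_add (hq : q ^ 2 + q + 1 = 0) : (C q : K⟦X⟧) ^ 2 + C q + 1 = 0 := by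
  rw [← map_pow, ← map_add, ← map_one (C (R := K)), ← map_add, hq, map_zero]

lemma algHom_geomSeries {σ : K⟦X⟧ →ₐ[K] K⟦X⟧} {w : K⟦X⟧} (hσ : σ X = w) (c : K) :
    (1 - C c * w) * σ (geomSeries c) = 1 := by
  have h := congrArg σ (one_sub_mul_geomSeries c)
  have hC : σ (C c) = C c := σ.commutes c
  rwa [map_mul, map_sub, map_mul, hC, hσ, map_one] at h

lemma algHom_geomSeries_one (hq : q ^ 2 + q + 1 = 0) {σ : K⟦X⟧ →ₐ[K] K⟦X⟧}
    (hσ : σ X = X * (C (q ^ 2) * geomSeries q)) :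
    σ (geomSeries 1) = C (q ^ 2) * -geomSeries (-1) + C (-q) := by
  have hG := one_sub_mul_geomSeries q
  have hW := one_sub_mul_geomSeries (-1 : K)
  have ha := algHom_geomSeries hσ 1
  have hQ := C_sq_add hq
  simp only [map_pow, map_neg, map_one] at *
  have h : (1 - X * (C q ^ 2 * geomSeries q)) * (C q ^ 2 * -geomSeries (-1) + -C q) = 1 := by
    linear_combination (1 + (1 - X * (C q ^ 2 * geomSeries q)) * C q) * hW -
      geomSeries (-1) * (X + (1 - X * (C q ^ 2 * geomSeries q))) * hQ -
      geomSeries (-1) * C q ^ 2 * X * hG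
  linear_combination (C q ^ 2 * -geomSeries (-1) + -C q) * ha - σ (geomSeries 1) * h

lemma algHom_geomSeries_neg_sq (hq : q ^ 2 + q + 1 = 0) {σ : K⟦X⟧ →ₐ[K] K⟦X⟧}
    (hσ : σ X = X * (C (q ^ 2) * geomSeries q)) :
    σ (C (-q) * geomSeries (-q ^ 2)) = C (q ^ 2) * X + C (-q) := by
  have hG := one_sub_mul_geomSeries q
  have ha := algHom_geomSeries hσ (-q ^ 2)
  have hQ := C_sq_add hq
  have hC : σ (C (-q)) = C (-q) := σ.commutes _
  rw [map_mul, hC]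
  simp only [map_pow, map_neg] at *
  have h : 1 - -C q ^ 2 * (X * (C q ^ 2 * geomSeries q)) = geomSeries q := by
    linear_combination X * geomSeries q * C q * (C q - 1) * hQ - hG
  rw [h] at ha
  linear_combination C q * σ (geomSeries (-q ^ 2)) * hG - C q * (1 - C q * X) * ha

lemma coeffDet_sub_eq (hq : q ^ 2 + q + 1 = 0) (n : ℕ) :
    coeffDet n (fun j => geomSeries (1 : K) ^ (j + 1) - (C (-q) * geomSeries (-q ^ 2)) ^ (j + 1)) =
      (1 + q) ^ n * coeffDet n fun j => X ^ (j + 1) - (-geomSeries (-1 : K)) ^ (j + 1) := by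
  have hq0 : q ≠ 0 := by rintro rfl; simp at hq
  have hs : HasSubst (X * (C (q ^ 2) * geomSeries q)) :=
    HasSubst.of_constantCoeff_zero' (by simp)
  obtain ⟨σ, hσ, hσX⟩ : ∃ σ : K⟦X⟧ →ₐ[K] K⟦X⟧,
      (∀ f, f.subst (X * (C (q ^ 2) * geomSeries q)) = σ f) ∧
      σ X = X * (C (q ^ 2) * geomSeries q) :=
    ⟨substAlgHom hs, fun f => by rw [coe_substAlgHom], by rw [coe_substAlgHom, subst_X hs]⟩
  have h1 := coeffDet_subst n (C (q ^ 2) * geomSeries q)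
    fun j => geomSeries (1 : K) ^ (j + 1) - (C (-q) * geomSeries (-q ^ 2)) ^ (j + 1)
  have h2 : coeffDet n (fun j => σ (geomSeries (1 : K) ^ (j + 1) -
      (C (-q) * geomSeries (-q ^ 2)) ^ (j + 1))) =
      (coeffDet n fun j => X ^ (j + 1) - (-geomSeries (-1 : K)) ^ (j + 1)) *
        ∏ i : Fin n, -((q ^ 2) ^ ((i : ℕ) + 1) * (-q) ^ ((i : ℕ) - i) *
          ((i : ℕ) + 1).choose ((i : ℕ) + 1)) := by
    refine coeffDet_of_upperTriangular
      (fun k j => -((q ^ 2) ^ (k + 1) * (-q) ^ (j - k) * (j + 1).choose (k + 1)))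
      (fun k j h => by simp [Nat.choose_eq_zero_of_lt (Nat.succ_lt_succ h)]) fun j hj => ?_
    rw [map_sub, map_pow, map_pow, algHom_geomSeries_one hq hσX,
      algHom_geomSeries_neg_sq hq hσX, add_pow, add_pow,
      ← Finset.sum_sub_distrib, Finset.sum_range_succ']
    simp only [pow_zero, sub_self, add_zero]
    refine Finset.sum_subset_zero_on_sdiff (Finset.range_mono hj) (fun k hk => ?_) fun k hk => ?_
    · simp only [Finset.mem_sdiff, Finset.mem_range, not_lt] at hk
      simp [Nat.choose_eq_zero_of_lt (show j + 1 < k + 1 by omega)]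
    · rw [Nat.add_sub_add_right]
      simp only [map_neg, map_mul, map_pow, map_natCast, mul_pow]
      ring
  simp only [hσ] at h1
  rw [h2] at h1
  have h3 : ∏ i : Fin n, -((q ^ 2) ^ ((i : ℕ) + 1) * (-q) ^ ((i : ℕ) - i) *
          (((i : ℕ) + 1).choose ((i : ℕ) + 1) : K)) =
      (1 + q) ^ n * ∏ i : Fin n, (q ^ 2) ^ (i : ℕ) := by
    have : 1 + q = -q ^ 2 := by linear_combination hq
    rw [this, ← Fin.prod_const n (-q ^ 2), ← Finset.prod_mul_distrib]
    refine Finset.prod_congr rfl fun i _ => ?_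
    simp
    ring
  have h4 : ∏ i : Fin n, (q ^ 2) ^ (i : ℕ) ≠ 0 :=
    Finset.prod_ne_zero_iff.2 fun i _ => pow_ne_zero _ (pow_ne_zero _ hq0)
  rw [h3, map_mul, constantCoeff_geomSeries, constantCoeff_C, mul_one] at h1
  refine mul_left_cancel₀ h4 ?_
  rw [← h1]
  ring

lemma coeffDet_sub_eq_mul_det (hq : q ^ 2 + q + 1 = 0) (n : ℕ) :
    coeffDet n (fun j => geomSeries (1 : K) ^ (j + 1) - (C (-q) * geomSeries (-q ^ 2)) ^ (j + 1)) =
      (1 + q) ^ n * (Matrix.of fun i j : Fin n => (((i : ℕ) + (j : ℕ)).choose (j : ℕ) : K) *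
        (1 - (-q) ^ ((j : ℤ) + 1 - (i : ℤ))) / (1 + q)).det := by
  have hq0 : -q ≠ 0 := neg_ne_zero.2 (by rintro rfl; simp at hq)
  have hq1 : 1 + q ≠ 0 := by
    rw [show 1 + q = -(-q) ^ 2 by linear_combination hq]
    exact neg_ne_zero.2 (pow_ne_zero _ hq0)
  have hinv : -q ^ 2 = (-q)⁻¹ := eq_inv_of_mul_eq_one_left (by linear_combination (q - 1) * hq)
  have hdet := Matrix.det_smul (Matrix.of fun i j : Fin n =>
    (((i : ℕ) + (j : ℕ)).choose (j : ℕ) : K) * (1 - (-q) ^ ((j : ℤ) + 1 - (i : ℤ))) / (1 + q))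
    (1 + q)
  rw [Fintype.card_fin] at hdet
  rw [← hdet, coeffDet]
  congr 1
  ext i j
  have hz : (-q) ^ ((j : ℤ) + 1 - (i : ℤ)) = (-q) ^ ((j : ℕ) + 1) * (-q ^ 2) ^ (i : ℕ) := by
    rw [zpow_sub₀ hq0, hinv, inv_pow, div_eq_mul_inv]
    norm_cast
  rw [Matrix.of_apply, Matrix.smul_apply, Matrix.of_apply, smul_eq_mul, mul_div_cancel₀ _ hq1, hz,
    map_sub, mul_pow, ← map_pow, coeff_C_mul, coeff_geomSeries_pow, coeff_geomSeries_pow]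
  ring

end

lemma exp_two_pi_div_three_sq_add :
    Complex.exp (2 * Real.pi * Complex.I / 3) ^ 2 + Complex.exp (2 * Real.pi * Complex.I / 3) + 1
      = 0 := by
  have h := (Complex.isPrimitiveRoot_exp 3 (by norm_num)).geom_sum_eq_zero (by norm_num)
  simp only [Finset.sum_range_succ, Finset.sum_range_zero] at h
  push_cast at h
  linear_combination h

end PowerSeriesDet

end ASM

/-- The number of `n×n` alternating sign matrices equals
`det_{0≤i,j≤n−1} ( C(i+j,j) · (1 − (−q)^{j+1−i})/(1+q) )` where `q = e^{2πi/3}`. -/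
theorem stmt18 (n : ℕ) (hn : 1 ≤ n) :
    (Nat.card {A : Matrix (Fin n) (Fin n) ℤ // IsASM n A} : ℂ) =
    Matrix.det (Matrix.of fun i j : Fin n =>
      (((i : ℕ) + (j : ℕ)).choose (j : ℕ) : ℂ) *
        (1 - (-(Complex.exp (2 * Real.pi * Complex.I / 3))) ^ ((j : ℤ) + 1 - (i : ℤ))) /
        (1 + Complex.exp (2 * Real.pi * Complex.I / 3))) := by
  have hq := ASM.exp_two_pi_div_three_sq_add
  set q := Complex.exp (2 * Real.pi * Complex.I / 3)
  have hq1 : 1 + q ≠ 0 := fun h => by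
    have : q = -1 := by linear_combination h
    norm_num [this] at hq
  have h := ASM.coeffDet_sub_eq_mul_det hq n
  rw [ASM.coeffDet_sub_eq hq, ← ASM.det_twoVarPoly_eq_coeffDet, ← ASM.pathCount_range_eq_det,
    ← ASM.card_isASM] at h
  exact_mod_cast mul_left_cancel₀ (pow_ne_zero n hq1) h
end

section
/- Let n ≥ 1 and let b_1 < b_2 < … < b_n be integers. Then Σ_M u^{inv(M)} (1−u)^{inv'(M)}, the sum over all monotone triangles M of order n with bottom row (b_1,…,b_n), equals ∏_{1≤i<j≤n} (b_j − b_i)/(j − i), as an identity of polynomials in u (in particular, the left-hand side is independent of u). -/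
open scoped BigOperators

/-- A monotone triangle of order `n`, encoded as a function `M : ℕ → ℕ → ℤ` (1-based indices,
`M i j` is the `j`-th entry of the `i`-th row, `1 ≤ j ≤ i ≤ n`), with `M i j = 0` off the
triangular shape.  Consecutive rows interlace weakly and every row except possibly the bottom
one is strictly increasing. -/
def IsMT (n : ℕ) (M : ℕ → ℕ → ℤ) : Prop :=
  (∀ i j, 1 ≤ j → j ≤ i → i < n → M (i+1) j ≤ M i j ∧ M i j ≤ M (i+1) (j+1)) ∧
  (∀ i j, 1 ≤ j → j < i → i < n → M i j < M i (j+1)) ∧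
  (∀ i j, ¬(1 ≤ j ∧ j ≤ i ∧ i ≤ n) → M i j = 0)

/-- `inv(M) = #{(i,j) : 1 ≤ j ≤ i < n, m_{i,j} = m_{i+1,j+1}}`. -/
def invMT (n : ℕ) (M : ℕ → ℕ → ℤ) : ℕ :=
  (((Finset.Icc 1 n) ×ˢ (Finset.Icc 1 n)).filter
    (fun p => p.2 ≤ p.1 ∧ p.1 < n ∧ M p.1 p.2 = M (p.1+1) (p.2+1))).card

/-- `inv'(M) = #{(i,j) : 1 ≤ j ≤ i < n, m_{i,j} = m_{i+1,j}}`. -/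
def invMT' (n : ℕ) (M : ℕ → ℕ → ℤ) : ℕ :=
  (((Finset.Icc 1 n) ×ˢ (Finset.Icc 1 n)).filter
    (fun p => p.2 ≤ p.1 ∧ p.1 < n ∧ M p.1 p.2 = M (p.1+1) p.2)).card

/-- The weight of an entry `c` lying above the adjacent entries `a`, `b` of the next row. -/
def entryWeight {R : Type*} [CommRing R] (u : R) (a b c : ℤ) : R :=
  (if c = b then u else 1) * (if c = a then 1 - u else 1)

section Algebra

open Polynomial Finset

variable {R : Type*} [CommRing R]

theorem sum_entryWeight_mul (u : R) (f g : ℤ → R)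
    (hg : ∀ x, g (x + 1) - g x = (1 - u) * f x + u * f (x + 1)) {a b : ℤ} (hab : a < b) :
    ∑ c ∈ Icc a b, entryWeight u a b c * f c = g b - g a := by
  have split : ∑ c ∈ Icc a b, entryWeight u a b c * f c
      = (1 - u) * f a + u * f b + ∑ c ∈ Ioo a b, f c := by
    have hIcc : Icc a b = insert a (insert b (Ioo a b)) := by
      ext c; simp only [mem_Icc, mem_insert, mem_Ioo]; omega
    rw [hIcc, sum_insert (by simp [hab.ne]), sum_insert (by simp), ← add_assoc]
    congr 1
    · simp [entryWeight, hab.ne, hab.ne']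
    · refine sum_congr rfl fun c hc => ?_
      rw [mem_Ioo] at hc
      simp [entryWeight, hc.1.ne', hc.2.ne]
  rw [split]
  clear split
  induction b, (show a + 1 ≤ b from hab) using Int.leInduction with
  | base =>
    have : Ioo a (a + 1) = ∅ := by ext c; simp only [mem_Ioo, notMem_empty, iff_false]; omega
    rw [this, hg, sum_empty, add_zero]
  | succ b hb ih =>
    have : Ioo a (b + 1) = insert b (Ioo a b) := by
      ext c; simp only [mem_insert, mem_Ioo]; omega
    rw [this, sum_insert (by simp)]
    linear_combination ih hb - hg b

/-- A monic polynomial of degree `k` whose forward difference is `k` times the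
`u`-weighted average of the falling factorial of degree `k - 1` at `x` and `x + 1`. -/
noncomputable def weightedFalling (u : R) (k : ℕ) : R[X] :=
  descPochhammer R k + C (u * k) * descPochhammer R (k - 1)

theorem descPochhammer_succ_eval_add_one (k : ℕ) (x : R) :
    (descPochhammer R (k + 1)).eval (x + 1) - (descPochhammer R (k + 1)).eval x
      = (k + 1) * (descPochhammer R k).eval x := by
  have h := congrArg (eval (x + 1)) (descPochhammer_succ_comp_X_sub_one (R := R) k)
  simp [eval_comp] at h
  rw [h]
  ring

theorem weightedFalling_succ_eval_add_one (u : R) (k : ℕ) (x : R) :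
    (weightedFalling u (k + 1)).eval (x + 1) - (weightedFalling u (k + 1)).eval x
      = (1 - u) * ((k + 1) * (descPochhammer R k).eval x)
        + u * ((k + 1) * (descPochhammer R k).eval (x + 1)) := by
  simp only [weightedFalling, eval_add, eval_mul, eval_C, Nat.add_sub_cancel]
  push_cast
  linear_combination descPochhammer_succ_eval_add_one k x

theorem det_eq_det_sub_pred {n : ℕ} (A : Matrix (Fin (n + 1)) (Fin (n + 1)) R)
    (hA : ∀ i, A i 0 = 1) :
    A.det = (Matrix.of fun i j : Fin n => A i.succ j.succ - A i.castSucc j.succ).det := by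
  let B : Matrix (Fin (n + 1)) (Fin (n + 1)) R :=
    Matrix.of (Fin.cons (A 0) fun i j => A i.succ j - A i.castSucc j)
  rw [Matrix.det_eq_of_forall_row_eq_smul_add_pred (A := A) (B := B) (fun _ => 1)
    (fun j => by simp [B]) (fun i j => by simp [B]), Matrix.det_succ_column_zero,
    Fin.sum_univ_succ, Finset.sum_eq_zero (fun i _ => by simp [B, hA])]
  simp only [B, Matrix.of_apply, Fin.cons_zero, hA, Fin.val_zero, pow_zero, one_mul, add_zero]
  rfl

variable [IsDomain R]

theorem degree_weightedFalling_lt (u : R) (k : ℕ) :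
    (C (u * k) * descPochhammer R (k - 1)).degree < (descPochhammer R k).degree := by
  rcases k with _ | k
  · simp
  · rw [← smul_eq_C_mul]
    refine (degree_smul_le _ _).trans_lt ?_
    rw [degree_eq_natDegree (monic_descPochhammer R _).ne_zero,
      degree_eq_natDegree (monic_descPochhammer R _).ne_zero]
    simp only [descPochhammer_natDegree]
    exact_mod_cast Nat.lt_succ_self k

theorem weightedFalling_monic (u : R) (k : ℕ) : (weightedFalling u k).Monic :=
  (monic_descPochhammer R k).add_of_left (degree_weightedFalling_lt u k)

theorem weightedFalling_natDegree (u : R) (k : ℕ) : (weightedFalling u k).natDegree = k := by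
  rw [weightedFalling, natDegree_add_eq_left_of_degree_lt (degree_weightedFalling_lt u k),
    descPochhammer_natDegree]

theorem sum_weight_mul_det_vandermonde (u : R) {n : ℕ} {b : Fin (n + 1) → ℤ}
    (hb : StrictMono b) :
    n.factorial * ∑ c ∈ Fintype.piFinset fun j : Fin n => Icc (b j.castSucc) (b j.succ),
      (∏ j, entryWeight u (b j.castSucc) (b j.succ) (c j))
        * (Matrix.vandermonde fun j => (c j : R)).det
      = (Matrix.vandermonde fun j => (b j : R)).det := by
  have hfac : (n.factorial : R) = ∏ j : Fin n, ((j : ℕ) + 1 : R) := by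
    rw [← Finset.prod_range_add_one_eq_factorial, ← Fin.prod_univ_eq_prod_range]
    push_cast
    rfl
  have hsum : ∀ i j : Fin n,
      ∑ x ∈ Icc (b i.castSucc) (b i.succ), entryWeight u (b i.castSucc) (b i.succ) x
          * (((j : ℕ) + 1) * (descPochhammer R j).eval (x : R))
        = (weightedFalling u (j + 1)).eval (b i.succ : R)
          - (weightedFalling u (j + 1)).eval (b i.castSucc : R) := fun i j =>
    sum_entryWeight_mul u (fun x => ((j : ℕ) + 1) * (descPochhammer R j).eval (x : R))
      (fun x => (weightedFalling u (j + 1)).eval (x : R))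
      (fun x => by push_cast; exact weightedFalling_succ_eval_add_one u j x)
      (hb Fin.castSucc_lt_succ)
  rw [Matrix.det_eval_matrixOfPolynomials_eq_det_vandermonde _ (fun i => weightedFalling u i)
    (fun i => weightedFalling_natDegree u i) (fun i => weightedFalling_monic u i),
    det_eq_det_sub_pred _ (fun i => by simp [weightedFalling])]
  simp only [Matrix.of_apply, Fin.val_succ, ← hsum]
  have hmulti := (Matrix.detRowAlternating (R := R) (n := Fin n)).toMultilinearMap.map_sum_finset
    (fun i (x : ℤ) (j : Fin n) => entryWeight u (b i.castSucc) (b i.succ) x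
      * (((j : ℕ) + 1) * (descPochhammer R j).eval (x : R)))
    (fun i => Icc (b i.castSucc) (b i.succ))
  have hrows : (Matrix.of fun i j : Fin n => ∑ x ∈ Icc (b i.castSucc) (b i.succ),
      entryWeight u (b i.castSucc) (b i.succ) x
          * (((j : ℕ) + 1) * (descPochhammer R j).eval (x : R)))
      = fun i => ∑ x ∈ Icc (b i.castSucc) (b i.succ), fun j : Fin n =>
        entryWeight u (b i.castSucc) (b i.succ) x
          * (((j : ℕ) + 1) * (descPochhammer R j).eval (x : R)) := by
    ext i j
    simp [Finset.sum_apply]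
  rw [hrows]
  refine Eq.trans ?_ hmulti.symm
  rw [Finset.mul_sum]
  refine sum_congr rfl fun c _ => ?_
  rw [Matrix.det_eval_matrixOfPolynomials_eq_det_vandermonde _ (fun i => descPochhammer R i)
    (fun i => descPochhammer_natDegree R i) (fun i => monic_descPochhammer R i), hfac,
    mul_left_comm, ← Matrix.det_mul_row, ← Matrix.det_mul_column]
  rfl

end Algebra

section Triangles

open Finset

/-- The array `M` with the entries of `b` put in as row `n + 1`. -/
def extendTriangle (n : ℕ) (b : Fin (n + 1) → ℤ) (M : ℕ → ℕ → ℤ) : ℕ → ℕ → ℤ := fun i j =>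
  if i = n + 1 then (if h : 1 ≤ j ∧ j ≤ n + 1 then b ⟨j - 1, by omega⟩ else 0) else M i j

theorem extendTriangle_of_le {n : ℕ} (b : Fin (n + 1) → ℤ) (M : ℕ → ℕ → ℤ) {i : ℕ} (hi : i ≤ n)
    (j : ℕ) : extendTriangle n b M i j = M i j := by
  rw [extendTriangle, if_neg (by omega)]

theorem extendTriangle_last {n : ℕ} (b : Fin (n + 1) → ℤ) (M : ℕ → ℕ → ℤ) (j : Fin (n + 1)) :
    extendTriangle n b M (n + 1) (j + 1) = b j := by
  rw [extendTriangle, if_pos rfl, dif_pos (by omega)]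
  rfl

open Classical in
/-- The monotone triangles of order `n` with bottom row `b`, built up row by row. -/
noncomputable def monotoneTriangles : (n : ℕ) → (Fin n → ℤ) → Finset (ℕ → ℕ → ℤ)
  | 0, _ => {0}
  | n + 1, b =>
    ((Fintype.piFinset fun j : Fin n => Icc (b j.castSucc) (b j.succ)).filter StrictMono).biUnion
      fun c => (monotoneTriangles n c).image (extendTriangle n b)

theorem Fin.strictMono_iff_lt_add_one {n : ℕ} {c : Fin n → ℤ} :
    StrictMono c ↔ ∀ j (h : j + 1 < n), c ⟨j, by omega⟩ < c ⟨j + 1, h⟩ := by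
  rcases n with _ | n
  · exact ⟨fun _ j h => by omega, fun _ i => i.elim0⟩
  · rw [Fin.strictMono_iff_lt_succ]
    exact ⟨fun h j hj => h ⟨j, by omega⟩, fun h i => h i (by omega)⟩

theorem isMT_extendTriangle {n : ℕ} {b : Fin (n + 1) → ℤ} {c : Fin n → ℤ} {M : ℕ → ℕ → ℤ}
    (hM : IsMT n M) (hMc : ∀ j : Fin n, M n (j + 1) = c j) (hc : StrictMono c)
    (hcb : ∀ j, b j.castSucc ≤ c j ∧ c j ≤ b j.succ) : IsMT (n + 1) (extendTriangle n b M) := by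
  obtain ⟨h1, h2, h3⟩ := hM
  refine ⟨fun i j hj hji hi => ?_, fun i j hj hji hi => ?_, fun i j hij => ?_⟩
  · rw [extendTriangle_of_le b M (by omega : i ≤ n)]
    rcases Nat.lt_succ_iff_lt_or_eq.mp hi with hi | rfl
    · rw [extendTriangle_of_le b M (by omega), extendTriangle_of_le b M (by omega)]
      exact h1 i j hj hji hi
    · obtain ⟨j, rfl⟩ := Nat.exists_eq_add_of_le' hj
      have e1 := extendTriangle_last b M (Fin.castSucc ⟨j, hji⟩)
      have e2 := extendTriangle_last b M (Fin.succ ⟨j, hji⟩)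
      have e3 := hMc ⟨j, hji⟩
      simp only [Fin.val_castSucc, Fin.val_succ] at e1 e2 e3
      rw [e1, e2, e3]
      exact hcb _
  · rw [extendTriangle_of_le b M (by omega), extendTriangle_of_le b M (by omega)]
    rcases Nat.lt_succ_iff_lt_or_eq.mp hi with hi | rfl
    · exact h2 i j hj hji hi
    · obtain ⟨j, rfl⟩ := Nat.exists_eq_add_of_le' hj
      have e1 := hMc ⟨j, by omega⟩
      have e2 := hMc ⟨j + 1, hji⟩
      simp only at e1 e2
      rw [e1, e2]
      exact Fin.strictMono_iff_lt_add_one.mp hc j hji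
  · by_cases hi : i = n + 1
    · rw [extendTriangle, if_pos hi, dif_neg (by omega)]
    · rw [extendTriangle, if_neg hi]
      exact h3 i j (by omega)

theorem IsMT.exists_eq_extendTriangle {n : ℕ} {b : Fin (n + 1) → ℤ} {M : ℕ → ℕ → ℤ}
    (hM : IsMT (n + 1) M) (hMb : ∀ j : Fin (n + 1), M (n + 1) (j + 1) = b j) :
    ∃ M', IsMT n M' ∧ (∀ j : Fin n, M' n (j + 1) = M n (j + 1)) ∧ extendTriangle n b M' = M := by
  obtain ⟨h1, h2, h3⟩ := hM
  refine ⟨fun i j => if i ≤ n then M i j else 0,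
    ⟨fun i j hj hji hi => ?_, fun i j hj hji hi => ?_, fun i j hij => ?_⟩, fun j => ?_, ?_⟩
  · simpa [hi.le, Nat.succ_le_of_lt hi] using h1 i j hj hji (by omega)
  · simpa [hi.le] using h2 i j hj hji (by omega)
  · dsimp only
    split_ifs with hi
    · exact h3 i j (by omega)
    · rfl
  · simp
  · funext i j
    by_cases hi : i = n + 1
    · subst hi
      by_cases hj : 1 ≤ j ∧ j ≤ n + 1
      · obtain ⟨j, rfl⟩ := Nat.exists_eq_add_of_le' hj.1
        have e := hMb ⟨j, by omega⟩
        simp only at e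
        rw [e]
        exact extendTriangle_last b _ ⟨j, by omega⟩
      · rw [extendTriangle, if_pos rfl, dif_neg hj, h3 _ _ (by omega)]
    · rw [extendTriangle, if_neg hi]
      split_ifs with h
      · rfl
      · rw [h3 _ _ (by omega)]

theorem mem_monotoneTriangles {n : ℕ} {b : Fin n → ℤ} {M : ℕ → ℕ → ℤ} :
    M ∈ monotoneTriangles n b ↔ IsMT n M ∧ ∀ j : Fin n, M n (j + 1) = b j := by
  induction n generalizing M with
  | zero =>
    rw [monotoneTriangles, mem_singleton]
    constructor
    · rintro rfl
      exact ⟨⟨by omega, by omega, fun _ _ _ => rfl⟩, fun j => j.elim0⟩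
    · rintro ⟨⟨-, -, h⟩, -⟩
      funext i j
      exact h i j (by omega)
  | succ n ih =>
    simp only [monotoneTriangles, mem_biUnion, mem_filter, Fintype.mem_piFinset, mem_Icc, mem_image,
      ih]
    constructor
    · rintro ⟨c, ⟨hcb, hc⟩, M, ⟨hM, hMc⟩, rfl⟩
      exact ⟨isMT_extendTriangle hM hMc hc hcb, extendTriangle_last b M⟩
    · rintro ⟨hM, hMb⟩
      obtain ⟨M', hM', hrow, hext⟩ := hM.exists_eq_extendTriangle hMb
      refine ⟨fun j => M n (j + 1), ⟨fun j => ?_, ?_⟩, M', ⟨hM', hrow⟩, hext⟩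
      · rw [← hMb, ← hMb]
        exact hM.1 n (j + 1) (by omega) (by omega) (by omega)
      · exact Fin.strictMono_iff_lt_add_one.mpr fun j hj =>
          hM.2.1 n (j + 1) (by omega) (by omega) (by omega)

theorem extendTriangle_injOn {n : ℕ} (b : Fin (n + 1) → ℤ) :
    Set.InjOn (extendTriangle n b) {M | IsMT n M} := by
  intro M hM M' hM' h
  funext i j
  by_cases hi : i ≤ n
  · rw [← extendTriangle_of_le b M hi, h, extendTriangle_of_le b M' hi]
  · rw [hM.2.2 i j (by omega), hM'.2.2 i j (by omega)]

theorem card_filter_triangle_succ (n : ℕ) (P : ℕ → ℕ → Prop) [∀ i j, Decidable (P i j)] :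
    ((Icc 1 (n + 1) ×ˢ Icc 1 (n + 1)).filter
        fun p => p.2 ≤ p.1 ∧ p.1 < n + 1 ∧ P p.1 p.2).card
      = ((Icc 1 n ×ˢ Icc 1 n).filter fun p => p.2 ≤ p.1 ∧ p.1 < n ∧ P p.1 p.2).card
        + (univ.filter fun j : Fin n => P n (j + 1)).card := by
  have hmap : (univ.filter fun j : Fin n => P n (j + 1)).card
      = ((univ.filter fun j : Fin n => P n (j + 1)).image
        fun j : Fin n => (n, (j : ℕ) + 1)).card :=
    (card_image_of_injective _ fun i j h => by simpa [Fin.ext_iff] using h).symm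
  rw [hmap, ← card_union_of_disjoint]
  · congr 1
    ext ⟨i, j⟩
    simp only [mem_filter, mem_product, mem_Icc, mem_union, mem_image, mem_univ, true_and,
      Prod.mk.injEq]
    constructor
    · rintro ⟨h, hji, hi, hP⟩
      rcases Nat.lt_succ_iff_lt_or_eq.mp hi with hi | rfl
      · exact Or.inl ⟨by omega, hji, hi, hP⟩
      · obtain ⟨j, rfl⟩ := Nat.exists_eq_add_of_le' h.2.1
        exact Or.inr ⟨⟨j, hji⟩, hP, rfl, rfl⟩
    · rintro (⟨h, hji, hi, hP⟩ | ⟨k, hP, rfl, rfl⟩)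
      · exact ⟨by omega, hji, by omega, hP⟩
      · have := k.isLt
        exact ⟨by omega, this, Nat.lt_succ_self _, hP⟩
  · rw [disjoint_left]
    rintro ⟨i, j⟩ h h'
    simp only [mem_filter, mem_image, Prod.mk.injEq] at h h'
    obtain ⟨k, -, rfl, -⟩ := h'
    exact lt_irrefl _ h.2.2.1

theorem invMT_extendTriangle {n : ℕ} (b : Fin (n + 1) → ℤ) (M : ℕ → ℕ → ℤ) :
    invMT (n + 1) (extendTriangle n b M)
      = invMT n M + (univ.filter fun j : Fin n => M n (j + 1) = b j.succ).card := by
  rw [invMT, card_filter_triangle_succ n fun i j =>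
    extendTriangle n b M i j = extendTriangle n b M (i + 1) (j + 1), invMT]
  congr 2
  · refine filter_congr fun p _ => and_congr_right fun _ => and_congr_right fun h => ?_
    rw [extendTriangle_of_le b M (by omega), extendTriangle_of_le b M (by omega)]
  · refine filter_congr fun j _ => ?_
    rw [extendTriangle_of_le b M le_rfl, ← extendTriangle_last b M j.succ, Fin.val_succ]

theorem invMT'_extendTriangle {n : ℕ} (b : Fin (n + 1) → ℤ) (M : ℕ → ℕ → ℤ) :
    invMT' (n + 1) (extendTriangle n b M)
      = invMT' n M + (univ.filter fun j : Fin n => M n (j + 1) = b j.castSucc).card := by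
  rw [invMT', card_filter_triangle_succ n fun i j =>
    extendTriangle n b M i j = extendTriangle n b M (i + 1) j, invMT']
  congr 2
  · refine filter_congr fun p _ => and_congr_right fun _ => and_congr_right fun h => ?_
    rw [extendTriangle_of_le b M (by omega), extendTriangle_of_le b M (by omega)]
  · refine filter_congr fun j _ => ?_
    rw [extendTriangle_of_le b M le_rfl, ← extendTriangle_last b M j.castSucc, Fin.val_castSucc]

variable {R : Type*} [CommRing R]

theorem prod_entryWeight (u : R) {n : ℕ} (b : Fin (n + 1) → ℤ) (c : Fin n → ℤ) :
    ∏ j, entryWeight u (b j.castSucc) (b j.succ) (c j)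
      = u ^ (univ.filter fun j => c j = b j.succ).card
        * (1 - u) ^ (univ.filter fun j => c j = b j.castSucc).card := by
  simp only [entryWeight, prod_mul_distrib]
  simp [prod_ite]

theorem sum_monotoneTriangles_succ (u : R) {n : ℕ} (b : Fin (n + 1) → ℤ) :
    ∑ M ∈ monotoneTriangles (n + 1) b, u ^ invMT (n + 1) M * (1 - u) ^ invMT' (n + 1) M
      = ∑ c ∈ Fintype.piFinset fun j : Fin n => Icc (b j.castSucc) (b j.succ),
        if StrictMono c then (∏ j, entryWeight u (b j.castSucc) (b j.succ) (c j))
          * ∑ M ∈ monotoneTriangles n c, u ^ invMT n M * (1 - u) ^ invMT' n M else 0 := by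
  classical
  rw [monotoneTriangles, sum_biUnion, ← sum_filter]
  · refine sum_congr (by congr) fun c _ => ?_
    rw [sum_image, mul_sum]
    · refine sum_congr rfl fun M hM => ?_
      have hrow := (mem_monotoneTriangles.mp hM).2
      simp only [invMT_extendTriangle, invMT'_extendTriangle, hrow, prod_entryWeight]
      ring
    · exact (extendTriangle_injOn b).mono fun M hM => (mem_monotoneTriangles.mp hM).1
  · intro c _ c' _ hne
    rw [Function.onFun, disjoint_left]
    intro M hM hM'
    obtain ⟨N, hN, rfl⟩ := mem_image.mp hM
    obtain ⟨N', hN', h⟩ := mem_image.mp hM'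
    rw [mem_monotoneTriangles] at hN hN'
    obtain rfl := extendTriangle_injOn b hN'.1 hN.1 h
    exact hne (funext fun j => by rw [← hN.2, ← hN'.2])

theorem det_vandermonde_eq_zero_of_not_strictMono [IsDomain R] {n : ℕ} {b : Fin (n + 1) → ℤ}
    {c : Fin n → ℤ} (hcb : ∀ j, b j.castSucc ≤ c j ∧ c j ≤ b j.succ) (hc : ¬ StrictMono c) :
    (Matrix.vandermonde fun j => (c j : R)).det = 0 := by
  rw [Fin.strictMono_iff_lt_add_one] at hc
  push Not at hc
  obtain ⟨j, hj, hle⟩ := hc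
  refine Matrix.det_vandermonde_eq_zero_iff.mpr ⟨⟨j, by omega⟩, ⟨j + 1, hj⟩, ?_, by simp⟩
  congr 1
  exact le_antisymm ((hcb ⟨j, by omega⟩).2.trans (hcb ⟨j + 1, hj⟩).1) hle

theorem det_vandermonde_val_succ (n : ℕ) :
    (Matrix.vandermonde fun i : Fin (n + 1) => ((i : ℕ) : R)).det
      = n.factorial * (Matrix.vandermonde fun i : Fin n => ((i : ℕ) : R)).det := by
  rw [Matrix.det_vandermonde_id_eq_superFactorial]
  rcases n with _ | n
  · simp
  · rw [Matrix.det_vandermonde_id_eq_superFactorial, Nat.superFactorial_succ, Nat.cast_mul]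

theorem det_vandermonde_mul_sum_monotoneTriangles [IsDomain R] (u : R) {n : ℕ} {b : Fin n → ℤ}
    (hb : StrictMono b) :
    (Matrix.vandermonde fun i : Fin n => ((i : ℕ) : R)).det
        * ∑ M ∈ monotoneTriangles n b, u ^ invMT n M * (1 - u) ^ invMT' n M
      = (Matrix.vandermonde fun j => (b j : R)).det := by
  induction n with
  | zero => simp [monotoneTriangles, invMT, invMT']
  | succ n ih =>
    rw [det_vandermonde_val_succ, sum_monotoneTriangles_succ, ← sum_weight_mul_det_vandermonde u hb,
      mul_assoc, mul_sum]
    congr 1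
    refine sum_congr rfl fun c hc => ?_
    simp only [Fintype.mem_piFinset, mem_Icc] at hc
    split_ifs with hmono
    · rw [mul_left_comm, ih hmono]
    · rw [det_vandermonde_eq_zero_of_not_strictMono hc hmono, mul_zero, mul_zero]

theorem prod_filter_lt_eq_det_vandermonde (n : ℕ) (f : ℕ → R) :
    ∏ p ∈ (Icc 1 n ×ˢ Icc 1 n).filter (fun p => p.1 < p.2), (f p.2 - f p.1)
      = (Matrix.vandermonde fun j : Fin n => f (j + 1)).det := by
  rw [Matrix.det_vandermonde, prod_sigma']
  refine (prod_bij (fun p _ => ((p.1 : ℕ) + 1, (p.2 : ℕ) + 1)) ?_ ?_ ?_ ?_).symm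
  · rintro ⟨i, j⟩ h
    simp only [mem_sigma, mem_univ, mem_Ioi, true_and, Fin.lt_def] at h
    simp only [mem_filter, mem_product, mem_Icc]
    omega
  · rintro ⟨i, j⟩ _ ⟨i', j'⟩ _ h
    simp only [Prod.mk.injEq, Nat.add_right_cancel_iff] at h
    rw [Fin.ext h.1, Fin.ext h.2]
  · rintro ⟨i, j⟩ h
    simp only [mem_filter, mem_product, mem_Icc] at h
    refine ⟨⟨⟨i - 1, by omega⟩, ⟨j - 1, by omega⟩⟩, ?_, ?_⟩
    · simp only [mem_sigma, mem_univ, mem_Ioi, true_and, Fin.lt_def]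
      omega
    · simp only [Prod.mk.injEq]
      omega
  · intro _ _
    rfl

end Triangles

/-- `Σ_M u^{inv(M)} (1−u)^{inv'(M)} = ∏_{1≤i<j≤n} (b_j − b_i)/(j − i)` in `ℚ[u]`. -/
theorem stmt19 (n : ℕ) (hn : 1 ≤ n) (b : ℕ → ℤ)
    (hb : ∀ i, 1 ≤ i → i < n → b i < b (i+1)) :
    (∑ᶠ M ∈ {M : ℕ → ℕ → ℤ | IsMT n M ∧ ∀ j ∈ Finset.Icc 1 n, M n j = b j},
      (Polynomial.X : Polynomial ℚ) ^ invMT n M * (1 - Polynomial.X) ^ invMT' n M) =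
    Polynomial.C (∏ p ∈ (Finset.Icc 1 n ×ˢ Finset.Icc 1 n).filter (fun p => p.1 < p.2),
      ((b p.2 : ℚ) - (b p.1 : ℚ)) / ((p.2 : ℚ) - (p.1 : ℚ))) := by
  have hmono : StrictMono fun j : Fin n => b (j + 1) :=
    Fin.strictMono_iff_lt_add_one.mpr fun j hj => hb (j + 1) (by omega) hj
  have hset : {M : ℕ → ℕ → ℤ | IsMT n M ∧ ∀ j ∈ Finset.Icc 1 n, M n j = b j}
      = monotoneTriangles n fun j => b (j + 1) := by
    ext M
    rw [Set.mem_ofPred_eq, Finset.mem_coe, mem_monotoneTriangles]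
    refine and_congr_right fun _ => ⟨fun h j => h _ (Finset.mem_Icc.mpr (by omega)),
      fun h j hj => ?_⟩
    rw [Finset.mem_Icc] at hj
    obtain ⟨j, rfl⟩ := Nat.exists_eq_add_of_le' hj.1
    exact h ⟨j, by omega⟩
  have hne : (Matrix.vandermonde fun i : Fin n => ((i : ℕ) : ℚ)).det ≠ 0 :=
    Matrix.det_vandermonde_ne_zero_iff.mpr fun i j h => Fin.ext (Nat.cast_injective h)
  have hC : ∀ f : Fin n → ℚ, (Matrix.vandermonde fun i => Polynomial.C (f i)).det
      = Polynomial.C (Matrix.vandermonde f).det := fun f => by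
    simp [Matrix.det_vandermonde]
  have key := det_vandermonde_mul_sum_monotoneTriangles (Polynomial.X : Polynomial ℚ) hmono
  rw [hset, finsum_mem_coe_finset, Finset.prod_div_distrib,
    prod_filter_lt_eq_det_vandermonde n fun i => (b i : ℚ),
    prod_filter_lt_eq_det_vandermonde n fun i => (i : ℚ)]
  simp only [Nat.cast_add, Nat.cast_one, Matrix.det_vandermonde_add]
  refine mul_left_cancel₀ (Polynomial.C_ne_zero.mpr hne) ?_
  rw [← Polynomial.C_mul, mul_div_cancel₀ _ hne, ← hC, ← hC]
  simpa using key
end
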